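/- arXiv:1907.01687 — 3 statements merged into one kernel-verified Lean document; each statement's English description precedes it below -/
import Mathlib

section
/- Let u be a smooth solution of the heat equation ∂_t u − Δu = 0 on [−2,0] × ℝ^d satisfying the exponential growth condition of order 2: |u(t,x)| ≤ A₁ e^{A₂|x|²} for all (t,x) ∈ [−2,0] × ℝ^d, where A₁, A₂ > 0. Then u is analytic in t on [−1,0] with a radius of convergence r > 0 depending only on d and A₂: there exist functions a_j : ℝ^d → ℝ such that for every x ∈ ℝ^d and every t ∈ [−1,0] with |t| < r, u(t,x) = Σ_{j=0}^∞ a_j(x) t^j / j!, where Δ a_j(x) = a_{j+1}(x) for all j, and there is a constant A₃ > 0 depending only on d and A₂ such that |a_j(x)| ≤ A₁ A₃^{j+1} j^j e^{2A₂|x|²} for all j = 0,1,2,… and all x ∈ ℝ^d. -/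
open Real Set

/-- The Laplacian of `f : ℝ^d → ℝ`: sum of second partial derivatives. -/
noncomputable def Lap {d : ℕ} (f : EuclideanSpace ℝ (Fin d) → ℝ)
    (x : EuclideanSpace ℝ (Fin d)) : ℝ :=
  ∑ i : Fin d,
    fderiv ℝ (fun y => fderiv ℝ f y (EuclideanSpace.single i 1)) x (EuclideanSpace.single i 1)

open Filter Topology

theorem second_deriv_nonpos_of_isLocalMax {h h₁ : ℝ → ℝ} {c s : ℝ}
    (hh : ∀ᶠ r in 𝓝 s, HasDerivAt h (h₁ r) r) (hh₁ : HasDerivAt h₁ c s)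
    (hmax : IsLocalMax h s) : c ≤ 0 := by
  by_contra! hc
  have hderiv : deriv h =ᶠ[𝓝 s] h₁ := hh.mono fun r hr => hr.deriv
  have hdd : deriv (deriv h) s = c := by rw [hderiv.deriv_eq, hh₁.deriv]
  have hmin : IsLocalMin h s :=
    isLocalMin_of_deriv_deriv_pos (by rwa [hdd]) hmax.deriv_eq_zero hh.self_of_nhds.continuousAt
  have hconst : h =ᶠ[𝓝 s] fun _ => h s := by
    filter_upwards [hmax, hmin] with r h1 h2 using le_antisymm h1 h2
  have hd : deriv h =ᶠ[𝓝 s] fun _ => 0 := by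
    filter_upwards [hconst.eventuallyEq_nhds] with r hr
    rw [hr.deriv_eq, deriv_const]
  rw [hd.deriv_eq, deriv_const] at hdd
  exact hc.ne hdd

theorem deriv_nonneg_of_forall_le_left {h : ℝ → ℝ} {a c t : ℝ} (hat : a < t)
    (hh : HasDerivAt h c t) (hmax : ∀ s ∈ Icc a t, h s ≤ h t) : 0 ≤ c := by
  have hloc : IsLocalMaxOn h (Icc a t) t :=
    IsMaxOn.localize fun s hs => hmax s hs
  have htan : a - t ∈ posTangentConeAt (Icc a t) t :=
    sub_mem_posTangentConeAt_of_segment_subset <| by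
      rw [segment_symm, segment_eq_Icc hat.le]
  have := hloc.hasFDerivWithinAt_nonpos hh.hasFDerivAt.hasFDerivWithinAt htan
  simp only [ContinuousLinearMap.toSpanSingleton_apply, smul_eq_mul] at this
  nlinarith

theorem bernstein_line_inequality {η η₁ g g₁ v v₁ : ℝ → ℝ} {η₂ g₂ v₂ lam s : ℝ}
    (hη : ∀ r, HasDerivAt η (η₁ r) r) (hη₁ : HasDerivAt η₁ η₂ s)
    (hg : ∀ᶠ r in 𝓝 s, HasDerivAt g (g₁ r) r) (hg₁ : HasDerivAt g₁ g₂ s)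
    (hv : ∀ᶠ r in 𝓝 s, HasDerivAt v (v₁ r) r) (hv₁ : HasDerivAt v₁ v₂ s)
    (hmax : IsLocalMax (fun r => η r ^ 2 * g r ^ 2 + lam * v r ^ 2) s) :
    (-6 * η₁ s ^ 2 + 2 * η s * η₂) * g s ^ 2 + 2 * η s ^ 2 * g s * g₂
      + 2 * lam * v₁ s ^ 2 + 2 * lam * v s * v₂ ≤ 0 := by
  have hfirst : ∀ᶠ r in 𝓝 s, HasDerivAt (fun r => η r ^ 2 * g r ^ 2 + lam * v r ^ 2)
      (2 * η r * η₁ r * g r ^ 2 + η r ^ 2 * (2 * g r * g₁ r) + lam * (2 * v r * v₁ r)) r := by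
    filter_upwards [hg, hv] with r hgr hvr
    refine ((((hη r).pow 2).mul (hgr.pow 2)).add ((hvr.pow 2).const_mul lam)).congr_deriv ?_
    simp
  have hg0 := hg.self_of_nhds
  have hv0 := hv.self_of_nhds
  have hsecond := ((((hη s).const_mul 2).mul hη₁).mul (hg0.pow 2)).add
    (((hη s).pow 2).mul ((hg0.const_mul 2).mul hg₁)) |>.add
    (((hv0.const_mul 2).mul hv₁).const_mul lam)
  have := second_deriv_nonpos_of_isLocalMax hfirst hsecond hmax
  simp only [Pi.mul_apply, Pi.pow_apply, Nat.cast_ofNat, Nat.add_one_sub_one, pow_one] at this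
  nlinarith [sq_nonneg (2 * η₁ s * g s + η s * g₁ s)]

/-- The derivative of `f` in the direction `w`. -/
noncomputable def dirDeriv {E : Type*} [NormedAddCommGroup E] [NormedSpace ℝ E] (w : E)
    (f : E → ℝ) (p : E) : ℝ :=
  fderiv ℝ f p w

section DirDeriv

variable {E : Type*} [NormedAddCommGroup E] [NormedSpace ℝ E] {U : Set E} {f g : E → ℝ} {p w : E}

theorem ContDiffOn.dirDeriv (hf : ContDiffOn ℝ (⊤ : ℕ∞) f U) (hU : IsOpen U) (w : E) :
    ContDiffOn ℝ (⊤ : ℕ∞) (dirDeriv w f) U :=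
  (hf.fderiv_of_isOpen hU (by simp)).clm_apply contDiffOn_const

theorem ContDiffOn.hasFDerivAt_of_isOpen (hf : ContDiffOn ℝ (⊤ : ℕ∞) f U) (hU : IsOpen U)
    (hp : p ∈ U) : HasFDerivAt f (fderiv ℝ f p) p :=
  ((hf.contDiffAt (hU.mem_nhds hp)).differentiableAt (by simp)).hasFDerivAt

theorem ContDiffOn.hasDerivAt_line (hf : ContDiffOn ℝ (⊤ : ℕ∞) f U) (hU : IsOpen U)
    {s : ℝ} (hp : p + s • w ∈ U) :
    HasDerivAt (fun r : ℝ => f (p + r • w)) (_root_.dirDeriv w f (p + s • w)) s := by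
  have hline : HasDerivAt (fun r : ℝ => p + r • w) w s := by
    simpa using ((hasDerivAt_id s).smul_const w).const_add p
  exact (hf.hasFDerivAt_of_isOpen hU hp).comp_hasDerivAt s hline

theorem dirDeriv_congr (hU : IsOpen U) (h : EqOn f g U) (w : E) :
    EqOn (dirDeriv w f) (dirDeriv w g) U := fun p hp => by
  unfold dirDeriv
  rw [(h.eventuallyEq_of_mem (hU.mem_nhds hp)).fderiv_eq]

theorem dirDeriv_comm (hU : IsOpen U) (hf : ContDiffOn ℝ (⊤ : ℕ∞) f U) (v w : E) :
    EqOn (dirDeriv v (dirDeriv w f)) (dirDeriv w (dirDeriv v f)) U := fun p hp => by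
  have hsymm : IsSymmSndFDerivAt ℝ f p :=
    (hf.contDiffAt (hU.mem_nhds hp)).isSymmSndFDerivAt (by
      simpa using WithTop.coe_le_coe.2 (le_top : (2 : ℕ∞) ≤ ⊤))
  have hd : DifferentiableAt ℝ (fderiv ℝ f) p :=
    ((hf.fderiv_of_isOpen hU (m := (⊤ : ℕ∞)) (by simp)).contDiffAt
      (hU.mem_nhds hp)).differentiableAt (by simp)
  have key (a b : E) : dirDeriv a (dirDeriv b f) p = fderiv ℝ (fderiv ℝ f) p a b := by
    change fderiv ℝ (fun q => fderiv ℝ f q b) p a = _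
    rw [fderiv_clm_apply hd (differentiableAt_const b)]
    simp
  rw [key, key, hsymm.eq]

theorem dirDeriv_sum {ι : Type*} (s : Finset ι) {F : ι → E → ℝ}
    (hU : IsOpen U) (hF : ∀ i, ContDiffOn ℝ (⊤ : ℕ∞) (F i) U) (w : E) (hp : p ∈ U) :
    dirDeriv w (fun q => ∑ i ∈ s, F i q) p = ∑ i ∈ s, dirDeriv w (F i) p := by
  unfold dirDeriv
  rw [fderiv_fun_sum fun i _ => ((hF i).hasFDerivAt_of_isOpen hU hp).differentiableAt]
  simp

end DirDeriv

/-- The `i`-th spatial coordinate direction in space-time. -/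
noncomputable def spaceDir {d : ℕ} (i : Fin d) : ℝ × EuclideanSpace ℝ (Fin d) :=
  (0, EuclideanSpace.single i 1)

/-- The time direction in space-time. -/
def timeDir (d : ℕ) : ℝ × EuclideanSpace ℝ (Fin d) :=
  (1, 0)

/-- Smooth solutions of the heat equation on an open subset of space-time. -/
structure IsHeatSolutionOn {d : ℕ} (U : Set (ℝ × EuclideanSpace ℝ (Fin d)))
    (f : ℝ × EuclideanSpace ℝ (Fin d) → ℝ) : Prop where
  contDiffOn : ContDiffOn ℝ (⊤ : ℕ∞) f U
  heat : ∀ p ∈ U, dirDeriv (timeDir d) f p = ∑ i, dirDeriv (spaceDir i) (dirDeriv (spaceDir i) f) p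

section Heat

variable {d : ℕ} {U : Set (ℝ × EuclideanSpace ℝ (Fin d))} {f : ℝ × EuclideanSpace ℝ (Fin d) → ℝ}

theorem IsHeatSolutionOn.dirDeriv (hf : IsHeatSolutionOn U f) (hU : IsOpen U)
    (w : ℝ × EuclideanSpace ℝ (Fin d)) : IsHeatSolutionOn U (dirDeriv w f) where
  contDiffOn := hf.contDiffOn.dirDeriv hU w
  heat p hp := by
    rw [dirDeriv_comm hU hf.contDiffOn _ _ hp, dirDeriv_congr hU hf.heat w hp,
      dirDeriv_sum _ hU (fun i => (hf.contDiffOn.dirDeriv hU _).dirDeriv hU _) w hp]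
    refine Finset.sum_congr rfl fun i _ => ?_
    rw [dirDeriv_comm hU (hf.contDiffOn.dirDeriv hU _) _ _ hp,
      dirDeriv_congr hU (dirDeriv_comm hU hf.contDiffOn w (spaceDir i)) _ hp]

theorem ContDiffOn.hasDerivAt_time (hf : ContDiffOn ℝ (⊤ : ℕ∞) f U) (hU : IsOpen U) {t : ℝ}
    {x : EuclideanSpace ℝ (Fin d)} (hp : (t, x) ∈ U) :
    HasDerivAt (fun s => f (s, x)) (_root_.dirDeriv (timeDir d) f (t, x)) t := by
  have := hf.hasDerivAt_line hU (p := (0, x)) (w := timeDir d) (s := t) (by simpa [timeDir])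
  simpa [timeDir] using this

theorem ContDiffOn.lap_slice (hf : ContDiffOn ℝ (⊤ : ℕ∞) f U) (hU : IsOpen U) {t : ℝ}
    {x : EuclideanSpace ℝ (Fin d)} (hp : (t, x) ∈ U) :
    Lap (fun y => f (t, y)) x =
      ∑ i, _root_.dirDeriv (spaceDir i) (_root_.dirDeriv (spaceDir i) f) (t, x) := by
  have slice {g : ℝ × EuclideanSpace ℝ (Fin d) → ℝ} (hg : ContDiffOn ℝ (⊤ : ℕ∞) g U)
      {y : EuclideanSpace ℝ (Fin d)} (hy : (t, y) ∈ U) (i : Fin d) :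
      fderiv ℝ (fun z => g (t, z)) y (EuclideanSpace.single i 1) =
        _root_.dirDeriv (spaceDir i) g (t, y) := by
    have h := (hg.hasFDerivAt_of_isOpen hU hy).comp y (hasFDerivAt_prodMk_right t y)
    rw [show (fun z => g (t, z)) = g ∘ (fun z => (t, z)) from rfl, h.fderiv]
    simp [_root_.dirDeriv, spaceDir]
  unfold Lap
  refine Finset.sum_congr rfl fun i _ => ?_
  rw [← slice (hf.dirDeriv hU _) hp]
  have hnear : ∀ᶠ y in 𝓝 x, (t, y) ∈ U :=
    (Continuous.prodMk_right t).continuousAt.eventually_mem (hU.mem_nhds hp)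
  have hEq : (fun y => fderiv ℝ (fun z => f (t, z)) y (EuclideanSpace.single i 1)) =ᶠ[𝓝 x]
      fun y => _root_.dirDeriv (spaceDir i) f (t, y) :=
    hnear.mono fun y hy => slice hf hy i
  rw [hEq.fderiv_eq]

theorem parabolic_cutoff_bound {φ ψ R a D : ℝ} (hR : 0 < R) (hφ₀ : 0 ≤ φ) (hφ₁ : φ ≤ 1)
    (hψ₀ : 0 ≤ ψ) (hψ₁ : ψ ≤ 1) (ha : a ≤ R ^ 2) (hD : 0 ≤ D) :
    2 * (φ * ψ) * (φ / R ^ 2) + 24 * ψ ^ 2 * a / R ^ 4 + 4 * D * (φ * ψ) * ψ / R ^ 2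
      < 2 * ((14 + 2 * D) / R ^ 2) := by
  have hR2 : 0 < R ^ 2 := by positivity
  have h1 : ψ ^ 2 ≤ 1 := pow_le_one₀ hψ₀ hψ₁
  have h2 : φ * ψ ≤ 1 := mul_le_one₀ hφ₁ hψ₀ hψ₁
  have h3 : φ * ψ * φ ≤ 1 := mul_le_one₀ h2 hφ₀ hφ₁
  have h4 : φ * ψ * ψ ≤ 1 := mul_le_one₀ h2 hψ₀ hψ₁
  have h5 : a / R ^ 2 ≤ 1 := (div_le_one hR2).2 ha
  have h6 : ψ ^ 2 * (a / R ^ 2) ≤ 1 := by nlinarith [sq_nonneg ψ]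
  have h7 : D * (φ * ψ * ψ) ≤ D := mul_le_of_le_one_right hD h4
  have : 2 * (φ * ψ) * (φ / R ^ 2) + 24 * ψ ^ 2 * a / R ^ 4 + 4 * D * (φ * ψ) * ψ / R ^ 2
      = (2 * (φ * ψ * φ) + 24 * (ψ ^ 2 * (a / R ^ 2)) + 4 * (D * (φ * ψ * ψ))) / R ^ 2 := by
    field_simp
  rw [this, ← mul_div_assoc 2]
  exact div_lt_div_of_pos_right (by linarith) hR2

/-- Interior gradient estimate on a parabolic cylinder, by the Bernstein method. -/
theorem IsHeatSolutionOn.abs_dirDeriv_le (hU : IsOpen U) (hf : IsHeatSolutionOn U f) {t₀ R M : ℝ}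
    {x₀ : EuclideanSpace ℝ (Fin d)} (hR : 0 < R)
    (hQ : Icc (t₀ - R ^ 2) t₀ ×ˢ Metric.closedBall x₀ R ⊆ U)
    (hM : ∀ p ∈ Icc (t₀ - R ^ 2) t₀ ×ˢ Metric.closedBall x₀ R, |f p| ≤ M) (i : Fin d) :
    |_root_.dirDeriv (spaceDir i) f (t₀, x₀)| ≤ √(14 + 2 * d) / R * M := by
  set Q := Icc (t₀ - R ^ 2) t₀ ×ˢ Metric.closedBall x₀ R
  set g := _root_.dirDeriv (spaceDir i) f
  have hg : IsHeatSolutionOn U g := hf.dirDeriv hU _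
  set φ : EuclideanSpace ℝ (Fin d) → ℝ := fun x => 1 - ‖x - x₀‖ ^ 2 / R ^ 2 with hφ
  set ψ : ℝ → ℝ := fun t => 1 + (t - t₀) / R ^ 2 with hψ
  set lam : ℝ := (14 + 2 * d) / R ^ 2 with hlam
  have hlam₀ : 0 < lam := by positivity
  set F : ℝ × EuclideanSpace ℝ (Fin d) → ℝ :=
    fun p => (φ p.2 * ψ p.1) ^ 2 * g p ^ 2 + lam * f p ^ 2 with hF
  have hR2 : 0 < R ^ 2 := by positivity
  have hcenter : (t₀, x₀) ∈ Q := by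
    refine ⟨⟨by linarith, le_rfl⟩, ?_⟩
    simp [hR.le]
  have hsq : ∀ p ∈ Q, f p ^ 2 ≤ M ^ 2 := fun p hp => sq_le_sq.2 ((hM p hp).trans (le_abs_self M))
  have hM₀ : 0 ≤ M := (abs_nonneg _).trans (hM _ hcenter)
  have hcont : ContinuousOn F Q := by
    have h1 : ContinuousOn f Q := hf.contDiffOn.continuousOn.mono hQ
    have h2 : ContinuousOn g Q := hg.contDiffOn.continuousOn.mono hQ
    have h3 : Continuous fun p : ℝ × EuclideanSpace ℝ (Fin d) => φ p.2 * ψ p.1 := by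
      simp only [hφ, hψ]
      fun_prop
    exact ((h3.continuousOn.pow 2).mul (h2.pow 2)).add (continuousOn_const.mul (h1.pow 2))
  have hcompact : IsCompact Q := isCompact_Icc.prod (isCompact_closedBall x₀ R)
  obtain ⟨⟨t, x⟩, hpQ, hpmax⟩ := hcompact.exists_isMaxOn ⟨_, hcenter⟩ hcont
  have hpU : (t, x) ∈ U := hQ hpQ
  have ht : t ∈ Icc (t₀ - R ^ 2) t₀ := hpQ.1
  have hx : ‖x - x₀‖ ≤ R := by simpa [dist_eq_norm] using hpQ.2
  have hvanish : φ x * ψ t * g (t, x) = 0 := by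
    rcases ht.1.eq_or_lt with hlo | hlo
    · have : ψ t = 0 := by
        simp only [hψ, ← hlo]
        field_simp
        ring
      simp [this]
    rcases hx.eq_or_lt with hbd | hbd
    · have : φ x = 0 := by
        simp only [hφ, hbd]
        field_simp
        ring
      simp [this]
    have htime : HasDerivAt (fun s => F (s, x)) _ t :=
      (((((hasDerivAt_id t).sub_const t₀).div_const (R ^ 2)).const_add 1 |>.const_mul (φ x)
        |>.pow 2).mul ((hg.contDiffOn.hasDerivAt_time hU hpU).pow 2)).add
        (((hf.contDiffOn.hasDerivAt_time hU hpU).pow 2).const_mul lam)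
    have htime₀ := deriv_nonneg_of_forall_le_left hlo htime fun s hs =>
      hpmax (a := (s, x)) ⟨⟨hs.1, hs.2.trans ht.2⟩, hpQ.2⟩
    have hspace (k : Fin d) :
        (-6 * (-(ψ t * (2 * (x k - x₀ k)) / R ^ 2)) ^ 2
            + 2 * (φ x * ψ t) * (-(2 * ψ t / R ^ 2))) * g (t, x) ^ 2
          + 2 * (φ x * ψ t) ^ 2 * g (t, x)
            * _root_.dirDeriv (spaceDir k) (_root_.dirDeriv (spaceDir k) g) (t, x)
          + 2 * lam * _root_.dirDeriv (spaceDir k) f (t, x) ^ 2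
          + 2 * lam * f (t, x)
            * _root_.dirDeriv (spaceDir k) (_root_.dirDeriv (spaceDir k) f) (t, x) ≤ 0 := by
      have hlinecont : Continuous fun r : ℝ => (t, x) + r • spaceDir k := by fun_prop
      have hnear : ∀ᶠ r : ℝ in 𝓝 0, (t, x) + r • spaceDir k ∈ U :=
        hlinecont.continuousAt.eventually_mem (hU.mem_nhds (by simpa using hpU))
      have hline {h : ℝ × EuclideanSpace ℝ (Fin d) → ℝ} (hh : ContDiffOn ℝ (⊤ : ℕ∞) h U) :
          ∀ᶠ r : ℝ in 𝓝 0, HasDerivAt (fun r : ℝ => h ((t, x) + r • spaceDir k))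
            (_root_.dirDeriv (spaceDir k) h ((t, x) + r • spaceDir k)) r :=
        hnear.mono fun r hr => hh.hasDerivAt_line hU hr
      have hφline (r : ℝ) : φ (x + r • EuclideanSpace.single k 1) =
          1 - (‖x - x₀‖ ^ 2 + 2 * r * (x k - x₀ k) + r ^ 2) / R ^ 2 := by
        have : x + r • EuclideanSpace.single k (1 : ℝ) - x₀
            = (x - x₀) + r • EuclideanSpace.single k 1 := by abel
        simp only [hφ]
        rw [this, norm_add_sq_real]
        simp [real_inner_smul_right, EuclideanSpace.inner_single_right, norm_smul]
        ring
      have hη (r : ℝ) : HasDerivAt (fun r => φ (x + r • EuclideanSpace.single k 1) * ψ t)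
          (-(ψ t * (2 * (x k - x₀ k) + 2 * r) / R ^ 2)) r := by
        simp only [hφline]
        have h := (((((hasDerivAt_id r).const_mul 2).mul_const (x k - x₀ k)).const_add
          (‖x - x₀‖ ^ 2)).add ((hasDerivAt_id r).pow 2)).div_const (R ^ 2) |>.const_sub 1
          |>.mul_const (ψ t)
        refine h.congr_deriv ?_
        simp
        ring
      have hη₁ : HasDerivAt (fun r => -(ψ t * (2 * (x k - x₀ k) + 2 * r) / R ^ 2))
          (-(2 * ψ t / R ^ 2)) 0 := by
        have h := ((((hasDerivAt_id (0 : ℝ)).const_mul 2).const_add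
          (2 * (x k - x₀ k))).const_mul (ψ t)).div_const (R ^ 2) |>.neg
        refine h.congr_deriv ?_
        ring
      have hmax : IsLocalMax (fun r : ℝ => (φ (x + r • EuclideanSpace.single k 1) * ψ t) ^ 2
          * g ((t, x) + r • spaceDir k) ^ 2 + lam * f ((t, x) + r • spaceDir k) ^ 2) 0 := by
        have hball : ∀ᶠ r : ℝ in 𝓝 0,
            x + r • EuclideanSpace.single k (1 : ℝ) ∈ Metric.ball x₀ R := by
          have hc : Continuous fun r : ℝ => x + r • EuclideanSpace.single k (1 : ℝ) := by fun_prop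
          exact hc.continuousAt.eventually_mem
            (Metric.isOpen_ball.mem_nhds (by simpa [dist_eq_norm] using hbd))
        filter_upwards [hball] with r hr
        have := hpmax (a := (t, x + r • EuclideanSpace.single k (1 : ℝ)))
          ⟨ht, Metric.ball_subset_closedBall hr⟩
        simpa [hF, spaceDir] using this
      have h := bernstein_line_inequality hη hη₁ (hline hg.contDiffOn)
        (hline (hg.contDiffOn.dirDeriv hU (spaceDir k))).self_of_nhds (hline hf.contDiffOn)
        (hline (hf.contDiffOn.dirDeriv hU (spaceDir k))).self_of_nhds hmax
      simpa using h
    have hsum := Finset.sum_nonpos fun k (_ : k ∈ Finset.univ) => hspace k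
    have hnorm : ∑ k, (x k - x₀ k) ^ 2 = ‖x - x₀‖ ^ 2 := by
      simp [EuclideanSpace.norm_sq_eq]
    have hgrad : g (t, x) ^ 2 ≤ ∑ k, _root_.dirDeriv (spaceDir k) f (t, x) ^ 2 :=
      Finset.single_le_sum (f := fun k => _root_.dirDeriv (spaceDir k) f (t, x) ^ 2)
        (fun _ _ => sq_nonneg _) (Finset.mem_univ i)
    have hsum' : (-(24 * ψ t ^ 2 * ‖x - x₀‖ ^ 2 / R ^ 4)
          - 4 * d * (φ x * ψ t) * ψ t / R ^ 2) * g (t, x) ^ 2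
        + 2 * (φ x * ψ t) ^ 2 * g (t, x) * _root_.dirDeriv (timeDir d) g (t, x)
        + 2 * lam * ∑ k, _root_.dirDeriv (spaceDir k) f (t, x) ^ 2
        + 2 * lam * f (t, x) * _root_.dirDeriv (timeDir d) f (t, x) ≤ 0 := by
      rw [hg.heat _ hpU, hf.heat _ hpU, ← hnorm]
      refine le_of_eq_of_le ?_ hsum
      have hcoeff (k : Fin d) : -6 * (-(ψ t * (2 * (x k - x₀ k)) / R ^ 2)) ^ 2
            + 2 * (φ x * ψ t) * (-(2 * ψ t / R ^ 2))
          = -(24 * ψ t ^ 2 / R ^ 4) * (x k - x₀ k) ^ 2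
            + -(4 * (φ x * ψ t) * ψ t / R ^ 2) := by ring
      simp only [hcoeff, Finset.sum_add_distrib, ← Finset.mul_sum, ← Finset.sum_mul]
      rw [Finset.sum_const, Finset.card_univ, Fintype.card_fin, nsmul_eq_mul]
      ring
    have hφ₀ : 0 ≤ φ x := by
      simp only [hφ, sub_nonneg]
      exact (div_le_one hR2).2 (pow_le_pow_left₀ (norm_nonneg _) hx 2)
    have hφ₁ : φ x ≤ 1 := by
      simp only [hφ, sub_le_self_iff]
      positivity
    have hψ₀ : 0 ≤ ψ t := by
      have : -1 ≤ (t - t₀) / R ^ 2 := by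
        rw [le_div_iff₀ hR2]
        linarith [ht.1]
      simp only [hψ]
      linarith
    have hψ₁ : ψ t ≤ 1 := by
      have : (t - t₀) / R ^ 2 ≤ 0 := div_nonpos_of_nonpos_of_nonneg (by linarith [ht.2]) hR2.le
      simp only [hψ]
      linarith
    have hK := parabolic_cutoff_bound hR hφ₀ hφ₁ hψ₀ hψ₁
      (pow_le_pow_left₀ (norm_nonneg _) hx 2) (Nat.cast_nonneg d : (0 : ℝ) ≤ d)
    have htime' : 0 ≤ 2 * (φ x * ψ t) * (φ x / R ^ 2) * g (t, x) ^ 2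
        + 2 * (φ x * ψ t) ^ 2 * g (t, x) * _root_.dirDeriv (timeDir d) g (t, x)
        + 2 * lam * f (t, x) * _root_.dirDeriv (timeDir d) f (t, x) := by
      refine htime₀.trans_eq ?_
      simp [hψ]
      ring
    have hg0 : g (t, x) ^ 2 ≤ 0 := by
      by_contra! hpos
      nlinarith [mul_lt_mul_of_pos_right hK hpos, mul_le_mul_of_nonneg_left hgrad hlam₀.le]
    rw [pow_eq_zero_iff two_ne_zero |>.1 (le_antisymm hg0 (sq_nonneg _)), mul_zero]
  have hbound : g (t₀, x₀) ^ 2 ≤ lam * M ^ 2 := by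
    have h1 : F (t₀, x₀) ≤ F (t, x) := hpmax hcenter
    have h2 : F (t, x) = lam * f (t, x) ^ 2 := by
      simp only [hF]
      rw [← mul_pow, hvanish]
      ring
    have h3 : g (t₀, x₀) ^ 2 ≤ F (t₀, x₀) := by
      have : 0 ≤ lam * f (t₀, x₀) ^ 2 := by positivity
      simpa [hF, hφ, hψ] using this
    exact h3.trans (h1.trans (h2.le.trans (mul_le_mul_of_nonneg_left (hsq _ hpQ) hlam₀.le)))
  refine abs_le_of_sq_le_sq (hbound.trans_eq ?_) (by positivity)
  rw [mul_pow, div_pow, Real.sq_sqrt (by positivity)]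

end Heat

section Iteration

variable {d : ℕ} {U : Set (ℝ × EuclideanSpace ℝ (Fin d))} {f : ℝ × EuclideanSpace ℝ (Fin d) → ℝ}

theorem IsHeatSolutionOn.iterate_timeDeriv (hU : IsOpen U) (hf : IsHeatSolutionOn U f) (n : ℕ) :
    IsHeatSolutionOn U ((_root_.dirDeriv (timeDir d))^[n] f) := by
  induction n with
  | zero => exact hf
  | succ n ih =>
    rw [Function.iterate_succ_apply']
    exact ih.dirDeriv hU _

theorem IsHeatSolutionOn.abs_spaceDeriv_le_of_growth (hU : IsOpen U) (hf : IsHeatSolutionOn U f)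
    (hcov : Icc (-2 : ℝ) 0 ×ˢ univ ⊆ U) {A c s τ R : ℝ} (hA : 0 ≤ A) (hc : 0 ≤ c) (hs : 0 ≤ s)
    (hτ : 0 ≤ τ) (hR : 0 < R)
    (hbound : ∀ t ∈ Icc (-2 + τ) 0, ∀ x, |f (t, x)| ≤ A * exp (c * (‖x‖ + s) ^ 2)) (i : Fin d) :
    ∀ t ∈ Icc (-2 + (τ + R ^ 2)) 0, ∀ x, |_root_.dirDeriv (spaceDir i) f (t, x)| ≤
      √(14 + 2 * d) / R * A * exp (c * (‖x‖ + (s + R)) ^ 2) := by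
  intro t ht x
  rw [mul_assoc]
  have htime {r : ℝ} (hr : r ∈ Icc (t - R ^ 2) t) : r ∈ Icc (-2 + τ) 0 :=
    ⟨by linarith [ht.1, hr.1], hr.2.trans ht.2⟩
  refine hf.abs_dirDeriv_le hU hR (fun p hp => ?_) (fun p hp => ?_) i
  · exact hcov ⟨⟨by linarith [(htime hp.1).1], (htime hp.1).2⟩, trivial⟩
  · refine (hbound p.1 (htime hp.1) p.2).trans ?_
    have hnorm : ‖p.2‖ ≤ ‖x‖ + R := by
      have h1 : ‖p.2 - x‖ ≤ R := by simpa [dist_eq_norm] using hp.2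
      linarith [norm_le_norm_add_norm_sub' p.2 x]
    have : ‖p.2‖ + s ≤ ‖x‖ + (s + R) := by linarith
    gcongr

theorem IsHeatSolutionOn.abs_timeDeriv_le_of_growth (hU : IsOpen U) (hf : IsHeatSolutionOn U f)
    (hcov : Icc (-2 : ℝ) 0 ×ˢ univ ⊆ U) {A c s τ R : ℝ} (hA : 0 ≤ A) (hc : 0 ≤ c) (hs : 0 ≤ s)
    (hτ : 0 ≤ τ) (hR : 0 < R)
    (hbound : ∀ t ∈ Icc (-2 + τ) 0, ∀ x, |f (t, x)| ≤ A * exp (c * (‖x‖ + s) ^ 2)) :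
    ∀ t ∈ Icc (-2 + (τ + 2 * R ^ 2)) 0, ∀ x, |_root_.dirDeriv (timeDir d) f (t, x)| ≤
      d * (14 + 2 * d) / R ^ 2 * A * exp (c * (‖x‖ + (s + 2 * R)) ^ 2) := by
  intro t ht x
  have hsecond (i : Fin d) := (hf.dirDeriv hU (spaceDir i)).abs_spaceDeriv_le_of_growth hU hcov
    (by positivity) hc (by positivity) (by positivity) hR
    (hf.abs_spaceDeriv_le_of_growth hU hcov hA hc hs hτ hR hbound i) i t
    ⟨by linarith [ht.1], ht.2⟩ x
  rw [hf.heat (t, x) (hcov ⟨⟨by nlinarith [ht.1], ht.2⟩, trivial⟩)]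
  refine (Finset.abs_sum_le_sum_abs _ _).trans
    ((Finset.sum_le_sum fun i _ => hsecond i).trans_eq ?_)
  rw [Finset.sum_const, Finset.card_univ, Fintype.card_fin, nsmul_eq_mul,
    show s + R + R = s + 2 * R by ring]
  have hsqrt : √(14 + 2 * (d : ℝ)) * √(14 + 2 * d) = 14 + 2 * d :=
    Real.mul_self_sqrt (by positivity)
  linear_combination d / R ^ 2 * A * exp (c * (‖x‖ + (s + 2 * R)) ^ 2) * hsqrt

theorem IsHeatSolutionOn.abs_iterate_timeDeriv_le (hU : IsOpen U) (hf : IsHeatSolutionOn U f)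
    (hcov : Icc (-2 : ℝ) 0 ×ˢ univ ⊆ U) {A c R : ℝ} (hA : 0 ≤ A) (hc : 0 ≤ c) (hR : 0 < R)
    (hbound : ∀ t ∈ Icc (-2 : ℝ) 0, ∀ x, |f (t, x)| ≤ A * exp (c * ‖x‖ ^ 2)) (n : ℕ) :
    ∀ t ∈ Icc (-2 + n * (2 * R ^ 2)) 0, ∀ x,
      |(_root_.dirDeriv (timeDir d))^[n] f (t, x)| ≤
        (d * (14 + 2 * d) / R ^ 2) ^ n * A * exp (c * (‖x‖ + n * (2 * R)) ^ 2) := by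
  induction n with
  | zero => simpa using hbound
  | succ n ih =>
    intro t ht x
    rw [Function.iterate_succ_apply']
    have h := (hf.iterate_timeDeriv hU n).abs_timeDeriv_le_of_growth hU hcov (by positivity) hc
      (by positivity) (by positivity) hR ih t (by push_cast at ht; convert ht using 2; ring) x
    refine h.trans_eq ?_
    push_cast
    ring_nf

/-- The constant governing the growth of the time derivatives. -/
noncomputable def timeDerivConst (d : ℕ) (c : ℝ) : ℝ :=
  2 * (d + 1) * (14 + 2 * d) * exp (4 * c)

theorem one_le_timeDerivConst (d : ℕ) {c : ℝ} (hc : 0 ≤ c) : 1 ≤ timeDerivConst d c := by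
  have h1 : 1 ≤ exp (4 * c) := one_le_exp (by positivity)
  have h2 : (1 : ℝ) ≤ 2 * (d + 1) * (14 + 2 * d) := by
    have : (0 : ℝ) ≤ d := d.cast_nonneg
    nlinarith
  exact one_le_mul_of_one_le_of_one_le h2 h1

theorem IsHeatSolutionOn.abs_iterate_timeDeriv_le_pow (hU : IsOpen U) (hf : IsHeatSolutionOn U f)
    (hcov : Icc (-2 : ℝ) 0 ×ˢ univ ⊆ U) {A c : ℝ} (hA : 0 ≤ A) (hc : 0 ≤ c)
    (hbound : ∀ t ∈ Icc (-2 : ℝ) 0, ∀ x, |f (t, x)| ≤ A * exp (c * ‖x‖ ^ 2)) (n : ℕ) :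
    ∀ t ∈ Icc (-1 : ℝ) 0, ∀ x, |(_root_.dirDeriv (timeDir d))^[n] f (t, x)| ≤
      A * timeDerivConst d c ^ (n + 1) * (n : ℝ) ^ n * exp (2 * c * ‖x‖ ^ 2) := by
  intro t ht x
  have hconst := one_le_timeDerivConst d hc
  rcases n.eq_zero_or_pos with rfl | hn
  · refine (hbound t ⟨by linarith [ht.1], ht.2⟩ x).trans ?_
    have h1 : A * 1 ≤ A * timeDerivConst d c := by gcongr
    have h2 : exp (c * ‖x‖ ^ 2) ≤ exp (2 * c * ‖x‖ ^ 2) := by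
      gcongr
      linarith
    simpa using mul_le_mul h1 h2 (by positivity) (by positivity)
  · have hn' : (0 : ℝ) < n := by exact_mod_cast hn
    set R : ℝ := (√(2 * n))⁻¹ with hRdef
    have hR : 0 < R := by positivity
    have hR2 : R ^ 2 = (2 * (n : ℝ))⁻¹ := by
      rw [hRdef, inv_pow, Real.sq_sqrt (by positivity)]
    have hnR : n * (2 * R ^ 2) = 1 := by
      rw [hR2]
      field_simp
    refine (hf.abs_iterate_timeDeriv_le hU hcov hA hc hR hbound n t
      ⟨by rw [hnR]; linarith [ht.1], ht.2⟩ x).trans ?_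
    have hexp : exp (c * (‖x‖ + n * (2 * R)) ^ 2) ≤ exp (4 * c) ^ n * exp (2 * c * ‖x‖ ^ 2) := by
      rw [← exp_nat_mul, ← exp_add, exp_le_exp]
      have h1 : (n * (2 * R)) ^ 2 = 2 * n := by
        rw [mul_pow, mul_pow, hR2]
        field_simp
      have h2 : (‖x‖ + n * (2 * R)) ^ 2 ≤ 2 * ‖x‖ ^ 2 + 4 * n := by
        nlinarith [sq_nonneg (‖x‖ - n * (2 * R))]
      nlinarith
    have hbase : d * (14 + 2 * d) / R ^ 2 ≤ (2 * (d + 1) * (14 + 2 * d)) * (n : ℝ) := by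
      rw [hR2, div_inv_eq_mul]
      nlinarith [mul_nonneg hn'.le (by positivity : (0 : ℝ) ≤ 14 + 2 * d)]
    calc (d * (14 + 2 * d) / R ^ 2) ^ n * A * exp (c * (‖x‖ + n * (2 * R)) ^ 2)
        ≤ ((2 * (d + 1) * (14 + 2 * d)) * (n : ℝ)) ^ n * A
            * (exp (4 * c) ^ n * exp (2 * c * ‖x‖ ^ 2)) := by gcongr
      _ = A * timeDerivConst d c ^ n * (n : ℝ) ^ n * exp (2 * c * ‖x‖ ^ 2) := by
        simp only [timeDerivConst, mul_pow]
        ring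
      _ ≤ A * timeDerivConst d c ^ (n + 1) * (n : ℝ) ^ n * exp (2 * c * ‖x‖ ^ 2) := by
        gcongr
        omega

end Iteration

theorem abs_sub_taylorSum_le {T B : ℝ} {n : ℕ} {G : ℕ → ℝ → ℝ}
    (hG : ∀ j, ∀ s ∈ Icc 0 T, HasDerivAt (G j) (G (j + 1) s) s)
    (hB : ∀ s ∈ Icc 0 T, |G n s| ≤ B) :
    ∀ s ∈ Icc 0 T, |G 0 s - ∑ j ∈ Finset.range n, G j 0 * s ^ j / (j.factorial : ℝ)| ≤
      B * s ^ n / (n.factorial : ℝ) := by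
  induction n generalizing G with
  | zero => simpa using hB
  | succ n ih =>
    have hIH := ih (G := fun j => G (j + 1)) (fun j => hG (j + 1)) hB
    have hterm (j : ℕ) (s : ℝ) : HasDerivAt
        (fun s => G (j + 1) 0 * s ^ (j + 1) / ((j + 1).factorial : ℝ))
        (G (j + 1) 0 * s ^ j / (j.factorial : ℝ)) s := by
      refine (((hasDerivAt_pow (j + 1) s).const_mul (G (j + 1) 0)).div_const
        ((j + 1).factorial : ℝ)).congr_deriv ?_
      rw [Nat.factorial_succ]
      push_cast
      field_simp
    have hderiv (s : ℝ) (hs : s ∈ Icc 0 T) : HasDerivAt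
        (fun s => G 0 s - ∑ j ∈ Finset.range (n + 1), G j 0 * s ^ j / (j.factorial : ℝ))
        (G 1 s - ∑ j ∈ Finset.range n, G (j + 1) 0 * s ^ j / (j.factorial : ℝ)) s := by
      simp only [Finset.sum_range_succ' _ n, pow_zero]
      exact (hG 0 s hs).sub ((HasDerivAt.fun_sum fun j _ => hterm j s).add_const _)
    have hmajor (s : ℝ) : HasDerivAt (fun s => B * s ^ (n + 1) / ((n + 1).factorial : ℝ))
        (B * s ^ n / (n.factorial : ℝ)) s := by
      refine (((hasDerivAt_pow (n + 1) s).const_mul B).div_const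
        ((n + 1).factorial : ℝ)).congr_deriv ?_
      rw [Nat.factorial_succ]
      push_cast
      field_simp
    refine image_norm_le_of_norm_deriv_right_le_deriv_boundary
      (fun s hs => (hderiv s hs).continuousAt.continuousWithinAt)
      (fun s hs => (hderiv s (Ico_subset_Icc_self hs)).hasDerivWithinAt) ?_ hmajor
      (fun s hs => hIH s (Ico_subset_Icc_self hs))
    simp [Finset.sum_range_succ']

theorem pow_self_div_factorial_le (n : ℕ) : (n : ℝ) ^ n / (n.factorial : ℝ) ≤ exp 1 ^ n := by
  rw [← exp_nat_mul, mul_one]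
  exact pow_div_factorial_le_exp n n.cast_nonneg n

theorem hasSum_taylor_of_abs_le {F : ℕ → ℝ → ℝ} {A K : ℝ} (hA : 0 < A) (hK : 0 ≤ K)
    (hF : ∀ j, ∀ t ∈ Icc (-1 : ℝ) 0, HasDerivAt (F j) (F (j + 1) t) t)
    (hbound : ∀ j, ∀ t ∈ Icc (-1 : ℝ) 0, |F j t| ≤ K * A ^ j * (j : ℝ) ^ j)
    {t : ℝ} (ht : t ∈ Icc (-1 : ℝ) 0) (htr : |t| < (2 * exp 1 * A)⁻¹) :
    HasSum (fun j : ℕ => F j 0 * t ^ j / (j.factorial : ℝ)) (F 0 t) := by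
  have hmajor (j : ℕ) : K * A ^ j * (j : ℝ) ^ j * |t| ^ j / (j.factorial : ℝ)
      ≤ K * (1 / 2) ^ j := by
    have hsmall : A * |t| * exp 1 ≤ 1 / 2 := by
      have := mul_le_mul_of_nonneg_left htr.le (by positivity : 0 ≤ exp 1 * A)
      calc A * |t| * exp 1 = exp 1 * A * |t| := by ring
        _ ≤ exp 1 * A * (2 * exp 1 * A)⁻¹ := this
        _ = 1 / 2 := by field_simp
    calc K * A ^ j * (j : ℝ) ^ j * |t| ^ j / (j.factorial : ℝ)
        = K * (A * |t|) ^ j * ((j : ℝ) ^ j / (j.factorial : ℝ)) := by ring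
      _ ≤ K * (A * |t|) ^ j * exp 1 ^ j := by
        gcongr
        exact pow_self_div_factorial_le j
      _ = K * (A * |t| * exp 1) ^ j := by ring
      _ ≤ K * (1 / 2) ^ j := by gcongr
  have hgeom : Summable fun j : ℕ => K * (1 / 2 : ℝ) ^ j :=
    summable_geometric_two.mul_left K
  have h0 : (0 : ℝ) ∈ Icc (-1 : ℝ) 0 := by simp
  have hsummable : Summable fun j : ℕ => ‖F j 0 * t ^ j / (j.factorial : ℝ)‖ := by
    refine hgeom.of_nonneg_of_le (fun _ => norm_nonneg _) fun j => le_trans ?_ (hmajor j)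
    rw [norm_div, norm_mul, norm_pow, Real.norm_eq_abs, Real.norm_eq_abs, RCLike.norm_natCast]
    gcongr
    exact hbound j 0 h0
  rw [hasSum_iff_tendsto_nat_of_summable_norm hsummable]
  set G : ℕ → ℝ → ℝ := fun j s => (-1) ^ j * F j (-s) with hGdef
  have hreflect {s : ℝ} (hs : s ∈ Icc (0 : ℝ) 1) : -s ∈ Icc (-1 : ℝ) 0 :=
    ⟨by linarith [hs.2], by linarith [hs.1]⟩
  have hG (j : ℕ) (s : ℝ) (hs : s ∈ Icc (0 : ℝ) 1) : HasDerivAt (G j) (G (j + 1) s) s := by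
    refine (((hF j (-s) (hreflect hs)).comp s (hasDerivAt_neg s)).const_mul
      ((-1) ^ j)).congr_deriv ?_
    simp only [hGdef]
    ring
  have hGbound (n : ℕ) (s : ℝ) (hs : s ∈ Icc (0 : ℝ) 1) : |G n s| ≤ K * A ^ n * (n : ℝ) ^ n := by
    simpa [hGdef, abs_mul, abs_pow] using hbound n (-s) (hreflect hs)
  rw [tendsto_iff_norm_sub_tendsto_zero]
  refine squeeze_zero (fun _ => norm_nonneg _) (fun n => ?_) hgeom.tendsto_atTop_zero
  have htaylor := abs_sub_taylorSum_le hG (hGbound n) (-t)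
    ⟨by linarith [ht.2], by linarith [ht.1]⟩
  rw [norm_sub_rev, Real.norm_eq_abs]
  refine le_trans (le_of_eq ?_) (htaylor.trans (le_trans (le_of_eq ?_) (hmajor n)))
  · simp only [hGdef, pow_zero, one_mul, neg_neg, neg_zero]
    congr 2
    refine Finset.sum_congr rfl fun j _ => ?_
    rw [neg_pow t]
    have : ((-1 : ℝ) ^ j) * (-1) ^ j = 1 := by rw [← mul_pow]; simp
    linear_combination -(F j 0 * t ^ j / (j.factorial : ℝ)) * this
  · rw [abs_of_nonpos ht.2]

/-- **Time analyticity of solutions of the heat equation of exponential growth of order 2.**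
Let `u` be a smooth solution of the heat equation `∂ₜu = Δu` on (a neighborhood of)
`[-2,0] × ℝ^d` with `|u(t,x)| ≤ A₁ exp(A₂ |x|²)`. Then `u` is analytic in `t` on `[-1,0]`
with radius of convergence `r > 0` depending only on `d` and `A₂`:
`u(t,x) = ∑_j a_j(x) tʲ/j!` with `Δ a_j = a_{j+1}` and
`|a_j(x)| ≤ A₁ A₃^{j+1} jʲ exp(2 A₂ |x|²)`, where `A₃` depends only on `d` and `A₂`. -/
theorem heat_time_analyticity (d : ℕ) (A₂ : ℝ) (hA₂ : 0 < A₂) :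
    ∃ r > (0:ℝ), ∃ A₃ > (0:ℝ),
      ∀ (u : ℝ → EuclideanSpace ℝ (Fin d) → ℝ) (A₁ : ℝ), 0 < A₁ →
      ∀ U : Set (ℝ × EuclideanSpace ℝ (Fin d)), IsOpen U →
        (Set.Icc (-2:ℝ) 0 ×ˢ (Set.univ : Set (EuclideanSpace ℝ (Fin d)))) ⊆ U →
        ContDiffOn ℝ (⊤ : ℕ∞) (fun p : ℝ × EuclideanSpace ℝ (Fin d) => u p.1 p.2) U →
        (∀ p ∈ U, deriv (fun s => u s p.2) p.1 = Lap (u p.1) p.2) →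
        (∀ t ∈ Set.Icc (-2:ℝ) 0, ∀ x, |u t x| ≤ A₁ * Real.exp (A₂ * ‖x‖^2)) →
        ∃ a : ℕ → EuclideanSpace ℝ (Fin d) → ℝ,
          (∀ (j : ℕ) (x), Lap (a j) x = a (j+1) x) ∧
          (∀ (j : ℕ) (x), |a j x| ≤ A₁ * A₃^(j+1) * (j:ℝ)^j * Real.exp (2 * A₂ * ‖x‖^2)) ∧
          (∀ x, ∀ t ∈ Set.Icc (-1:ℝ) 0, |t| < r →
            HasSum (fun j : ℕ => a j x * t^j / (Nat.factorial j : ℝ)) (u t x)) := by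
  have hconst := one_le_timeDerivConst d hA₂.le
  have hconst₀ : 0 < timeDerivConst d A₂ := one_pos.trans_le hconst
  refine ⟨(2 * exp 1 * timeDerivConst d A₂)⁻¹, by positivity, timeDerivConst d A₂, hconst₀, ?_⟩
  intro u A₁ hA₁ U hU hcov hsmooth hheat hbound
  set f : ℝ × EuclideanSpace ℝ (Fin d) → ℝ := fun p => u p.1 p.2
  have hf : IsHeatSolutionOn U f := by
    refine ⟨hsmooth, fun p hp => ?_⟩
    rw [← hsmooth.lap_slice hU (t := p.1) (x := p.2) hp]
    exact (hsmooth.hasDerivAt_time hU (t := p.1) (x := p.2) hp).deriv.symm.trans (hheat p hp)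
  have hmem {t : ℝ} (ht : t ∈ Set.Icc (-1 : ℝ) 0) (x : EuclideanSpace ℝ (Fin d)) : (t, x) ∈ U :=
    hcov ⟨⟨by linarith [ht.1], ht.2⟩, trivial⟩
  have h0 : (0 : ℝ) ∈ Set.Icc (-1 : ℝ) 0 := by simp
  have hderivs := hf.abs_iterate_timeDeriv_le_pow hU hcov hA₁.le hA₂.le hbound
  refine ⟨fun j x => (dirDeriv (timeDir d))^[j] f (0, x), fun j x => ?_,
    fun j x => hderivs j 0 h0 x, fun x t ht htr => ?_⟩
  · have hj := hf.iterate_timeDeriv hU j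
    rw [hj.contDiffOn.lap_slice hU (hmem h0 x), ← hj.heat _ (hmem h0 x)]
    simp only [Function.iterate_succ_apply']
  · refine hasSum_taylor_of_abs_le (F := fun j s => (dirDeriv (timeDir d))^[j] f (s, x))
      (K := A₁ * timeDerivConst d A₂ * exp (2 * A₂ * ‖x‖ ^ 2)) hconst₀ (by positivity)
      (fun j s hs => ?_) (fun j s hs => ?_) ht htr
    · simp only [Function.iterate_succ_apply']
      exact (hf.iterate_timeDeriv hU j).contDiffOn.hasDerivAt_time hU (hmem hs x)
    · exact (hderivs j s hs x).trans_eq (by ring)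
end

section
/- Suppose the Cauchy problem for the backward heat equation ∂_t u + Δu = 0 on (0,δ) × ℝ^d with initial value u(0,x) = a(x) has a smooth solution u of exponential growth of order 2 (i.e., |u(t,x)| ≤ A₁ e^{A₂|x|²} for some positive constants A₁, A₂) for some δ > 0. Then there exist positive constants A₃ and A₄ such that |Δ^j a(x)| ≤ A₃^{j+1} j^j e^{A₄|x|²} for all j = 0,1,2,… and all x ∈ ℝ^d. -/
open Real Set

/-- Spatial directional derivatives of a jointly smooth function are restrictions of its total
derivative. -/
theorem fderiv_slice_eq_fderivWithin {E : Type*} [NormedAddCommGroup E] [NormedSpace ℝ E]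
    {I : Set ℝ} {w : ℝ → E → ℝ}
    (hw : ContDiffOn ℝ (⊤ : ℕ∞) (fun p : ℝ × E => w p.1 p.2) (I ×ˢ univ)) (v : E)
    {t : ℝ} (ht : t ∈ I) (x : E) :
    fderiv ℝ (w t) x v =
      fderivWithin ℝ (fun p : ℝ × E => w p.1 p.2) (I ×ˢ univ) (t, x) (0, v) := by
  have h1 := ((hw.differentiableOn (by simp)) (t, x) ⟨ht, mem_univ _⟩).hasFDerivWithinAt
  have h2 : HasFDerivWithinAt (fun y : E => (t, y)) (ContinuousLinearMap.inr ℝ ℝ E) univ x :=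
    (hasFDerivAt_prodMk_right t x).hasFDerivWithinAt
  have h3 := (h1.comp x h2 (fun y _ => ⟨ht, mem_univ _⟩)).hasFDerivAt Filter.univ_mem
  have h4 : fderiv ℝ (w t) x = _ := h3.fderiv
  rw [h4]
  simp

theorem ContDiffOn.fderiv_slice {E : Type*} [NormedAddCommGroup E] [NormedSpace ℝ E]
    {I : Set ℝ} (hI : UniqueDiffOn ℝ I) {w : ℝ → E → ℝ}
    (hw : ContDiffOn ℝ (⊤ : ℕ∞) (fun p : ℝ × E => w p.1 p.2) (I ×ˢ univ)) (v : E) :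
    ContDiffOn ℝ (⊤ : ℕ∞) (fun p : ℝ × E => fderiv ℝ (w p.1) p.2 v) (I ×ˢ univ) := by
  have h := hw.fderivWithin (hI.prod uniqueDiffOn_univ) (m := (⊤ : ℕ∞)) (by simp)
  refine (h.clm_apply (contDiffOn_const (c := ((0 : ℝ), v)))).congr fun p hp => ?_
  exact fderiv_slice_eq_fderivWithin hw v hp.1 p.2

theorem ContDiffOn.lap_slice_s2 {d : ℕ} {I : Set ℝ} (hI : UniqueDiffOn ℝ I)
    {w : ℝ → EuclideanSpace ℝ (Fin d) → ℝ}
    (hw : ContDiffOn ℝ (⊤ : ℕ∞) (fun p : ℝ × EuclideanSpace ℝ (Fin d) => w p.1 p.2)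
      (I ×ˢ univ)) :
    ContDiffOn ℝ (⊤ : ℕ∞) (fun p : ℝ × EuclideanSpace ℝ (Fin d) => Lap (w p.1) p.2)
      (I ×ˢ univ) := by
  unfold Lap
  refine ContDiffOn.sum fun i _ => ?_
  exact (hw.fderiv_slice hI _).fderiv_slice
    (w := fun t y => fderiv ℝ (w t) y (EuclideanSpace.single i 1)) hI _

/-- Time and space derivatives of a jointly smooth function commute. -/
theorem hasDerivAt_fderiv_slice {E : Type*} [NormedAddCommGroup E] [NormedSpace ℝ E]
    {I : Set ℝ} (hI : IsOpen I) {w : ℝ → E → ℝ}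
    (hw : ContDiffOn ℝ (⊤ : ℕ∞) (fun p : ℝ × E => w p.1 p.2) (I ×ˢ univ)) (v : E)
    {t : ℝ} (ht : t ∈ I) (x : E) :
    HasDerivAt (fun s => fderiv ℝ (w s) x v)
      (fderiv ℝ (fun y => deriv (fun s => w s y) t) x v) t := by
  set W : ℝ × E → ℝ := fun p => w p.1 p.2 with hW
  have hS : IsOpen (I ×ˢ (univ : Set E)) := hI.prod isOpen_univ
  have hat : ∀ s ∈ I, ∀ y, ContDiffAt ℝ (⊤ : ℕ∞) W (s, y) := fun s hs y =>
    hw.contDiffAt (hS.mem_nhds ⟨hs, mem_univ _⟩)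
  have hdiff : ∀ s ∈ I, ∀ y, HasFDerivAt W (fderiv ℝ W (s, y)) (s, y) := fun s hs y =>
    ((hat s hs y).differentiableAt (by simp)).hasFDerivAt
  have hspace : ∀ s ∈ I, ∀ y, fderiv ℝ (w s) y v = fderiv ℝ W (s, y) (0, v) := by
    intro s hs y
    rw [fderiv_slice_eq_fderivWithin hw v hs y, fderivWithin_of_isOpen hS ⟨hs, mem_univ _⟩]
  have htime : ∀ y, deriv (fun s => w s y) t = fderiv ℝ W (t, y) (1, 0) := by
    intro y
    have := (hdiff t ht y).comp_hasDerivAt t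
      ((hasDerivAt_id t).prodMk (hasDerivAt_const t y))
    exact this.deriv
  have hD : HasFDerivAt (fderiv ℝ W) (fderiv ℝ (fderiv ℝ W) (t, x)) (t, x) :=
    (((hat t ht x).fderiv_right (m := (⊤ : ℕ∞)) (by simp)).differentiableAt
      (by simp)).hasFDerivAt
  have hsymm : IsSymmSndFDerivAt ℝ W (t, x) :=
    (hat t ht x).isSymmSndFDerivAt (by
      rw [minSmoothness_of_isRCLikeNormedField]; exact WithTop.coe_le_coe.2 le_top)
  have hev : ∀ q : ℝ × E, HasFDerivAt (fun p => fderiv ℝ W p q)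
      ((fderiv ℝ (fderiv ℝ W) (t, x)).flip q) (t, x) := fun q => by
    simpa using hD.clm_apply (hasFDerivAt_const q (t, x))
  have hRHS : fderiv ℝ (fun y => deriv (fun s => w s y) t) x v
      = fderiv ℝ (fderiv ℝ W) (t, x) (0, v) (1, 0) := by
    have h1 : HasFDerivAt (fun y => fderiv ℝ W (t, y) (1, 0)) _ x :=
      (hev (1, 0)).comp x (hasFDerivAt_prodMk_right t x)
    rw [funext htime, h1.fderiv]
    rfl
  rw [hRHS, hsymm.eq]
  have h2 : HasDerivAt (fun s => fderiv ℝ W (s, x) (0, v)) _ t :=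
    HasFDerivAt.comp_hasDerivAt (f := fun s => (s, x)) t (hev (0, v))
      ((hasDerivAt_id' t).prodMk (hasDerivAt_const t x))
  refine h2.congr_of_eventuallyEq ?_
  filter_upwards [hI.mem_nhds ht] with s hs
  exact hspace s hs x

/-- The Laplacian of a jointly smooth backward caloric function is backward caloric. -/
theorem hasDerivAt_lap_slice {d : ℕ} {I : Set ℝ} (hI : IsOpen I)
    {w : ℝ → EuclideanSpace ℝ (Fin d) → ℝ}
    (hw : ContDiffOn ℝ (⊤ : ℕ∞) (fun p : ℝ × EuclideanSpace ℝ (Fin d) => w p.1 p.2)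
      (I ×ˢ univ))
    (hpde : ∀ t ∈ I, ∀ x, HasDerivAt (fun s => w s x) (-Lap (w t) x) t)
    {t : ℝ} (ht : t ∈ I) (x : EuclideanSpace ℝ (Fin d)) :
    HasDerivAt (fun s => Lap (w s) x) (-Lap (Lap (w t)) x) t := by
  have h : -Lap (Lap (w t)) x = ∑ i : Fin d, fderiv ℝ (fun y => deriv (fun s =>
      fderiv ℝ (w s) y (EuclideanSpace.single i 1)) t) x (EuclideanSpace.single i 1) := by
    rw [Lap, ← Finset.sum_neg_distrib]
    refine Finset.sum_congr rfl fun i _ => ?_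
    simp_rw [fun y => (hasDerivAt_fderiv_slice hI hw (EuclideanSpace.single i 1) ht y).deriv,
      fun y => (hpde t ht y).deriv, fderiv_fun_neg, neg_apply,
      fderiv_fun_neg, neg_apply]
  rw [h]
  unfold Lap
  refine HasDerivAt.fun_sum fun i _ => ?_
  exact hasDerivAt_fderiv_slice (w := fun t y => fderiv ℝ (w t) y (EuclideanSpace.single i 1))
    hI (hw.fderiv_slice hI.uniqueDiffOn _) _ ht x

theorem ContDiff.fderiv_dir {E : Type*} [NormedAddCommGroup E] [NormedSpace ℝ E]
    {f : E → ℝ} (hf : ContDiff ℝ (⊤ : ℕ∞) f) (v : E) :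
    ContDiff ℝ (⊤ : ℕ∞) (fun y => fderiv ℝ f y v) :=
  (hf.fderiv_right (m := (⊤ : ℕ∞)) (by simp)).clm_apply contDiff_const

theorem ContDiff.lap {d : ℕ} {f : EuclideanSpace ℝ (Fin d) → ℝ}
    (hf : ContDiff ℝ (⊤ : ℕ∞) f) : ContDiff ℝ (⊤ : ℕ∞) (Lap f) := by
  unfold Lap
  exact ContDiff.sum fun i _ => (hf.fderiv_dir _).fderiv_dir _

theorem integral_fderiv_mul_eq_neg {d : ℕ} {f g : EuclideanSpace ℝ (Fin d) → ℝ}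
    (hf : ContDiff ℝ (⊤ : ℕ∞) f) (hg : ContDiff ℝ (⊤ : ℕ∞) g) (hc : HasCompactSupport g)
    (v : EuclideanSpace ℝ (Fin d)) :
    ∫ x, fderiv ℝ f x v * g x = -∫ x, f x * fderiv ℝ g x v := by
  have hc' : HasCompactSupport (fun x => fderiv ℝ g x v) := hc.fderiv_apply ℝ v
  rw [integral_mul_fderiv_eq_neg_fderiv_mul_of_integrable, neg_neg]
  · exact ((hf.fderiv_dir v).continuous.mul hg.continuous).integrable_of_hasCompactSupport
      hc.mul_left
  · exact (hf.continuous.mul (hg.fderiv_dir v).continuous).integrable_of_hasCompactSupport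
      hc'.mul_left
  · exact (hf.continuous.mul hg.continuous).integrable_of_hasCompactSupport hc.mul_left
  · exact fun x _ => hf.differentiable (by simp) x
  · exact fun x _ => hg.differentiable (by simp) x

/-- Green's identity on the whole space. -/
theorem integral_lap_mul {d : ℕ} {f g : EuclideanSpace ℝ (Fin d) → ℝ}
    (hf : ContDiff ℝ (⊤ : ℕ∞) f) (hg : ContDiff ℝ (⊤ : ℕ∞) g) (hc : HasCompactSupport g) :
    ∫ x, Lap f x * g x = ∫ x, f x * Lap g x := by
  simp only [Lap, Finset.sum_mul, Finset.mul_sum]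
  rw [MeasureTheory.integral_finsetSum, MeasureTheory.integral_finsetSum]
  · refine Finset.sum_congr rfl fun i _ => ?_
    rw [integral_fderiv_mul_eq_neg (hf.fderiv_dir _) hg hc,
      integral_fderiv_mul_eq_neg hf (hg.fderiv_dir _) (hc.fderiv_apply ℝ _), neg_neg]
  · intro i _
    exact (hf.continuous.mul
      ((hg.fderiv_dir _).fderiv_dir _).continuous).integrable_of_hasCompactSupport
      ((hc.fderiv_apply ℝ _).fderiv_apply ℝ _).mul_left
  · intro i _
    exact (((hf.fderiv_dir _).fderiv_dir _).continuous.mul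
      hg.continuous).integrable_of_hasCompactSupport hc.mul_left

theorem lap_mul {d : ℕ} {f g : EuclideanSpace ℝ (Fin d) → ℝ}
    (hf : ContDiff ℝ (⊤ : ℕ∞) f) (hg : ContDiff ℝ (⊤ : ℕ∞) g) (x : EuclideanSpace ℝ (Fin d)) :
    Lap (fun y => f y * g y) x = Lap f x * g x + f x * Lap g x
      + 2 * ∑ i, fderiv ℝ f x (EuclideanSpace.single i 1)
        * fderiv ℝ g x (EuclideanSpace.single i 1) := by
  have key : ∀ {f g : EuclideanSpace ℝ (Fin d) → ℝ}, ContDiff ℝ (⊤ : ℕ∞) f →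
      ContDiff ℝ (⊤ : ℕ∞) g → ∀ y v, fderiv ℝ (fun y => f y * g y) y v
        = f y * fderiv ℝ g y v + g y * fderiv ℝ f y v := by
    intro f g hf hg y v
    rw [fderiv_fun_mul (hf.differentiable (by simp) y) (hg.differentiable (by simp) y)]
    simp
  simp only [Lap, Finset.sum_mul, Finset.mul_sum, ← Finset.sum_add_distrib]
  refine Finset.sum_congr rfl fun i _ => ?_
  rw [funext fun y => key hf hg y (EuclideanSpace.single i 1),
    fderiv_fun_add ((hf.mul (hg.fderiv_dir _)).differentiable (by simp) x)
      ((hg.mul (hf.fderiv_dir _)).differentiable (by simp) x), add_apply,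
    key hf (hg.fderiv_dir _), key hg (hf.fderiv_dir _)]
  ring

/-- Differentiation under the integral sign for integrands supported in a fixed compact set. -/
theorem hasDerivAt_integral_of_compact {d : ℕ} {I : Set ℝ} (hI : IsOpen I)
    {k : Set (EuclideanSpace ℝ (Fin d))} (hk : IsCompact k)
    {f f' : ℝ → EuclideanSpace ℝ (Fin d) → ℝ}
    (hf : ∀ s ∈ I, Continuous (f s))
    (hf' : ContinuousOn (fun p : ℝ × EuclideanSpace ℝ (Fin d) => f' p.1 p.2) (I ×ˢ univ))
    (hd : ∀ s ∈ I, ∀ y, HasDerivAt (fun s => f s y) (f' s y) s)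
    (hfk : ∀ s, ∀ y ∉ k, f s y = 0) (hfk' : ∀ s, ∀ y ∉ k, f' s y = 0)
    {s : ℝ} (hs : s ∈ I) :
    HasDerivAt (fun s => ∫ y, f s y) (∫ y, f' s y) s := by
  obtain ⟨r, hr, hrI⟩ := Metric.nhds_basis_closedBall.mem_iff.1 (hI.mem_nhds hs)
  obtain ⟨C, hC⟩ := ((isCompact_closedBall s r).prod hk).exists_bound_of_continuousOn
    (hf'.mono (prod_mono hrI (subset_univ _)))
  have hcont' : Continuous (f' s) := by
    rw [← continuousOn_univ]
    exact hf'.comp (f := fun y => (s, y)) (by fun_prop) fun y _ => ⟨hs, mem_univ _⟩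
  refine (hasDerivAt_integral_of_dominated_loc_of_deriv_le
    (bound := k.indicator fun _ => C) (Metric.closedBall_mem_nhds s hr)
    ?_ ?_ ?_ ?_ ?_ ?_).2
  · filter_upwards [hI.mem_nhds hs] with s' hs'
    exact (hf s' hs').aestronglyMeasurable
  · exact (hf s hs).integrable_of_hasCompactSupport (HasCompactSupport.intro hk (hfk s))
  · exact hcont'.aestronglyMeasurable
  · refine Filter.Eventually.of_forall fun y s' hs' => ?_
    by_cases hy : y ∈ k
    · rw [indicator_of_mem hy]
      exact hC (s', y) ⟨hs', hy⟩
    · rw [indicator_of_notMem hy, hfk' s' y hy, norm_zero]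
  · rw [MeasureTheory.integrable_indicator_iff hk.measurableSet]
    exact MeasureTheory.integrableOn_const hk.measure_lt_top.ne
  · exact Filter.Eventually.of_forall fun y s' hs' => hd s' (hrI hs') y

/-- The heat kernel, up to a multiplicative constant. -/
noncomputable def heatKer {d : ℕ} (s : ℝ) (y : EuclideanSpace ℝ (Fin d)) : ℝ :=
  Real.exp (-(d / 2) * Real.log s - ‖y‖ ^ 2 / (4 * s))

theorem heatKer_pos {d : ℕ} (s : ℝ) (y : EuclideanSpace ℝ (Fin d)) : 0 < heatKer s y :=
  Real.exp_pos _

theorem contDiff_heatKer {d : ℕ} (s : ℝ) :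
    ContDiff ℝ (⊤ : ℕ∞) (heatKer s : EuclideanSpace ℝ (Fin d) → ℝ) := by
  unfold heatKer
  exact (contDiff_const.sub ((contDiff_norm_sq ℝ).div_const _)).exp

theorem fderiv_heatKer {d : ℕ} (s : ℝ) (y : EuclideanSpace ℝ (Fin d)) (i : Fin d) :
    fderiv ℝ (heatKer s) y (EuclideanSpace.single i 1) = -(y i / (2 * s)) * heatKer s y := by
  have h1 : HasFDerivAt (fun y : EuclideanSpace ℝ (Fin d) => ‖y‖ ^ 2) (2 • innerSL ℝ y) y :=
    (hasStrictFDerivAt_norm_sq y).hasFDerivAt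
  have h2 := ((h1.mul_const (4 * s)⁻¹).const_sub (-(d / 2) * Real.log s)).exp
  have h3 : HasFDerivAt (heatKer s) _ y := h2
  rw [h3.fderiv]
  simp [EuclideanSpace.inner_single_right, heatKer, div_eq_mul_inv]
  ring

theorem lap_heatKer {d : ℕ} (s : ℝ) (y : EuclideanSpace ℝ (Fin d)) :
    Lap (heatKer s) y = (-(d / 2) * s⁻¹ + ‖y‖ ^ 2 / (4 * s ^ 2)) * heatKer s y := by
  have h : ∀ i : Fin d, fderiv ℝ (fun y => fderiv ℝ (heatKer s) y
      (EuclideanSpace.single i 1)) y (EuclideanSpace.single i 1)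
      = (-(1 / 2) * s⁻¹ + (y i) ^ 2 / (4 * s ^ 2)) * heatKer s y := by
    intro i
    rw [funext fun y => fderiv_heatKer s y i]
    have h1 : HasFDerivAt (fun y : EuclideanSpace ℝ (Fin d) => -(y i / (2 * s)))
        (-((2 * s)⁻¹ • (EuclideanSpace.proj i : EuclideanSpace ℝ (Fin d) →L[ℝ] ℝ))) y := by
      exact ((EuclideanSpace.proj i : EuclideanSpace ℝ (Fin d) →L[ℝ] ℝ).hasFDerivAt.mul_const
        (2 * s)⁻¹).fun_neg
    have h2 := h1.fun_mul (((contDiff_heatKer s).differentiable (by simp) y).hasFDerivAt)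
    rw [h2.fderiv]
    simp [fderiv_heatKer, div_eq_mul_inv]
    ring
  rw [Lap, Finset.sum_congr rfl fun i _ => h i, ← Finset.sum_mul, Finset.sum_add_distrib,
    ← Finset.sum_div, ← EuclideanSpace.real_norm_sq_eq]
  simp only [Finset.sum_const, Finset.card_univ, Fintype.card_fin, nsmul_eq_mul]
  ring

/-- The heat kernel solves the heat equation. -/
theorem hasDerivAt_heatKer {d : ℕ} {s : ℝ} (hs : 0 < s) (y : EuclideanSpace ℝ (Fin d)) :
    HasDerivAt (fun s => heatKer s y) (Lap (heatKer s) y) s := by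
  have h1 := (((Real.hasDerivAt_log hs.ne').const_mul (-(d / 2 : ℝ))).sub
    ((hasDerivAt_const s (‖y‖ ^ 2)).div ((hasDerivAt_id' s).const_mul 4) (by positivity))).exp
  rw [lap_heatKer]
  refine h1.congr_deriv ?_
  simp only [heatKer, Pi.div_apply, Pi.sub_apply]
  field_simp
  ring_nf

theorem integrable_exp_neg_mul_norm_sq {d : ℕ} {b : ℝ} (hb : 0 < b) :
    MeasureTheory.Integrable
      (fun y : EuclideanSpace ℝ (Fin d) => Real.exp (-b * ‖y‖ ^ 2)) := by
  have h := (GaussianFourier.integrable_cexp_neg_mul_sq_norm_add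
    (V := EuclideanSpace ℝ (Fin d)) (b := (b : ℂ)) (by simpa using hb) 0 0).norm
  refine h.congr (Filter.Eventually.of_forall fun y => ?_)
  simp only [Complex.norm_exp]
  simp [← Complex.ofReal_pow, ← Complex.ofReal_mul, ← Complex.ofReal_neg, -neg_mul]

theorem fderiv_comp_const_smul {E : Type*} [NormedAddCommGroup E] [NormedSpace ℝ E]
    {f : E → ℝ} (hf : ContDiff ℝ (⊤ : ℕ∞) f) (ε : ℝ) (y v : E) :
    fderiv ℝ (fun y => f (ε • y)) y v = ε * fderiv ℝ f (ε • y) v := by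
  have h := ((hf.differentiable (by simp) (ε • y)).hasFDerivAt).comp y
    ((hasFDerivAt_id y).const_smul ε)
  have h' : HasFDerivAt (fun y => f (ε • y)) _ y := h
  rw [h'.fderiv]
  simp

/-- Smooth cutoff functions at scale `1 / ε`. -/
theorem exists_cutoff (d : ℕ) : ∃ M : ℝ, 0 ≤ M ∧ ∀ ε : ℝ, 0 < ε → ε ≤ 1 →
    ∃ χ : EuclideanSpace ℝ (Fin d) → ℝ, ContDiff ℝ (⊤ : ℕ∞) χ ∧ HasCompactSupport χ ∧
      (∀ y, |χ y| ≤ 1) ∧ (∀ y, ‖y‖ < 1 / ε → χ y = 1) ∧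
      (∀ y i, |fderiv ℝ χ y (EuclideanSpace.single i 1)| ≤ ε * M) ∧
      (∀ y, |Lap χ y| ≤ ε * M) := by
  let χ₀ : ContDiffBump (0 : EuclideanSpace ℝ (Fin d)) := ⟨1, 2, one_pos, one_lt_two⟩
  have hsm : ContDiff ℝ (⊤ : ℕ∞) χ₀ := χ₀.contDiff
  have hcs : HasCompactSupport χ₀ := χ₀.hasCompactSupport
  have h1 : ∀ i : Fin d, ∃ C, ∀ y, |fderiv ℝ χ₀ y (EuclideanSpace.single i 1)| ≤ C := fun i =>
    (hcs.fderiv_apply ℝ _).exists_bound_of_continuous (hsm.fderiv_dir _).continuous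
  have h2 : ∀ i : Fin d, ∃ C, ∀ y, |fderiv ℝ (fun y => fderiv ℝ χ₀ y
      (EuclideanSpace.single i 1)) y (EuclideanSpace.single i 1)| ≤ C := fun i =>
    ((hcs.fderiv_apply ℝ _).fderiv_apply ℝ _).exists_bound_of_continuous
      ((hsm.fderiv_dir _).fderiv_dir _).continuous
  choose C hC using h1
  choose D hD using h2
  have hC0 : ∀ i, 0 ≤ C i := fun i => (abs_nonneg _).trans (hC i 0)
  have hD0 : ∀ i, 0 ≤ D i := fun i => (abs_nonneg _).trans (hD i 0)
  have hsC : 0 ≤ ∑ i, C i := Finset.sum_nonneg fun i _ => hC0 i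
  have hsD : 0 ≤ ∑ i, D i := Finset.sum_nonneg fun i _ => hD0 i
  refine ⟨∑ i, C i + ∑ i, D i, add_nonneg hsC hsD, fun ε hε hε1 => ?_⟩
  refine ⟨fun y => χ₀ (ε • y), hsm.comp (contDiff_const_smul ε),
    hcs.comp_homeomorph (Homeomorph.smulOfNeZero ε hε.ne'), ?_, ?_, ?_, ?_⟩
  · intro y
    rw [abs_of_nonneg χ₀.nonneg]
    exact χ₀.le_one
  · intro y hy
    refine χ₀.one_of_mem_closedBall ?_
    rw [mem_closedBall_zero_iff, norm_smul, Real.norm_of_nonneg hε.le]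
    rw [lt_div_iff₀ hε] at hy
    change ε * ‖y‖ ≤ 1
    linarith
  · intro y i
    rw [fderiv_comp_const_smul hsm, abs_mul, abs_of_pos hε]
    refine mul_le_mul_of_nonneg_left ((hC i _).trans ?_) hε.le
    have := Finset.single_le_sum (fun i _ => hC0 i) (Finset.mem_univ i)
    linarith
  · intro y
    have : Lap (fun y => χ₀ (ε • y)) y = ε * (ε * Lap χ₀ (ε • y)) := by
      rw [Lap, Lap, Finset.mul_sum, Finset.mul_sum]
      refine Finset.sum_congr rfl fun i _ => ?_
      rw [funext fun y => fderiv_comp_const_smul hsm ε y (EuclideanSpace.single i 1),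
        fderiv_const_mul (by exact
          (((hsm.fderiv_dir _).comp (contDiff_const_smul ε)).differentiable (by simp)) y), smul_apply, smul_eq_mul,
        fderiv_comp_const_smul (hsm.fderiv_dir _)]
    rw [this, abs_mul, abs_of_pos hε]
    refine mul_le_mul_of_nonneg_left ?_ hε.le
    rw [abs_mul, abs_of_pos hε]
    have h3 : |Lap χ₀ (ε • y)| ≤ ∑ i, D i :=
      (Finset.abs_sum_le_sum_abs _ _).trans (Finset.sum_le_sum fun i _ => hD i _)
    calc ε * |Lap χ₀ (ε • y)| ≤ 1 * ∑ i, D i := by gcongr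
      _ ≤ _ := by linarith

/-- Off the unit ball, the heat kernel and its first derivatives are small uniformly in time. -/
theorem exists_heatKer_mul_le (d : ℕ) : ∃ C : ℝ, 0 ≤ C ∧ ∀ T s : ℝ, 0 < s → s ≤ T →
    ∀ y : EuclideanSpace ℝ (Fin d), 1 ≤ ‖y‖ →
      heatKer s y * (‖y‖ / s + 1) ≤ C * Real.exp (-(8 * T)⁻¹ * ‖y‖ ^ 2) := by
  refine ⟨8 ^ (d + 1) * (d + 1).factorial * Real.exp (1 / 8), by positivity, ?_⟩
  intro T s hs hsT y hy
  set q := ‖y‖ ^ 2 / s with hq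
  have hq0 : 0 ≤ q := by positivity
  have hy2 : ‖y‖ ≤ ‖y‖ ^ 2 := by nlinarith
  have h1 : ‖y‖ / s ≤ q := by rw [hq]; gcongr
  have h2 : -(d / 2) * Real.log s ≤ d * Real.log (1 + q) := by
    have h3 : -Real.log s ≤ Real.log (1 + q) := by
      rw [← Real.log_inv]
      refine Real.log_le_log (by positivity) ?_
      have : s⁻¹ ≤ q := by
        rw [hq, div_eq_mul_inv]
        exact le_mul_of_one_le_left (by positivity) (by nlinarith)
      linarith
    have h4 : 0 ≤ Real.log (1 + q) := Real.log_nonneg (by linarith)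
    have h5 : (0 : ℝ) ≤ d := by positivity
    nlinarith [mul_le_mul_of_nonneg_left h3 h5, mul_nonneg h5 h4]
  have h6 : (1 + q) ^ (d + 1) ≤ 8 ^ (d + 1) * (d + 1).factorial * Real.exp ((1 + q) / 8) := by
    have := Real.pow_div_factorial_le_exp ((1 + q) / 8) (by positivity) (d + 1)
    rw [div_pow, div_div, div_le_iff₀ (by positivity)] at this
    linarith
  have h7 : ‖y‖ ^ 2 / (4 * s) = q / 8 + q / 8 := by rw [hq]; field_simp; norm_num
  have h8 : (8 * T)⁻¹ * ‖y‖ ^ 2 ≤ q / 8 := by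
    rw [hq, div_div, div_eq_mul_inv, mul_comm]
    gcongr ?_ * ?_
    exact inv_anti₀ (by positivity) (by linarith)
  calc heatKer s y * (‖y‖ / s + 1)
      ≤ Real.exp (d * Real.log (1 + q) - q / 8 - (8 * T)⁻¹ * ‖y‖ ^ 2) * (1 + q) := by
        refine mul_le_mul (Real.exp_le_exp.2 ?_) (by linarith) (by positivity) (by positivity)
        rw [h7]
        linarith
    _ = (1 + q) ^ (d + 1) * Real.exp (-(q / 8)) * Real.exp (-(8 * T)⁻¹ * ‖y‖ ^ 2) := by
        rw [sub_sub, Real.exp_sub, Real.exp_add, mul_comm (d : ℝ), Real.exp_mul,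
          Real.exp_log (by positivity), Real.rpow_natCast, pow_succ, neg_mul, Real.exp_neg,
          Real.exp_neg]
        field_simp
        ring
    _ ≤ (8 ^ (d + 1) * (d + 1).factorial * Real.exp ((1 + q) / 8)) * Real.exp (-(q / 8))
          * Real.exp (-(8 * T)⁻¹ * ‖y‖ ^ 2) := by gcongr
    _ = _ := by
        rw [mul_assoc _ (Real.exp ((1 + q) / 8)), ← Real.exp_add]
        congr 3
        ring

/-- There are cutoff functions for which the cut-off heat kernel almost solves the heat
equation. -/
theorem exists_cutoff_heatKer (d : ℕ) : ∃ M : ℝ, 0 ≤ M ∧ ∀ ε : ℝ, 0 < ε → ε ≤ 1 →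
    ∃ χ : EuclideanSpace ℝ (Fin d) → ℝ, ContDiff ℝ (⊤ : ℕ∞) χ ∧ HasCompactSupport χ ∧
      (∀ y, |χ y| ≤ 1) ∧ (∀ y, ‖y‖ < 1 / ε → χ y = 1) ∧
      ∀ T s : ℝ, 0 < s → s ≤ T → ∀ y,
        |Lap (fun y => heatKer s y * χ y) y - Lap (heatKer s) y * χ y|
          ≤ ε * M * Real.exp (-(8 * T)⁻¹ * ‖y‖ ^ 2) := by
  obtain ⟨M, hM, H⟩ := exists_cutoff d
  obtain ⟨C, hC, HC⟩ := exists_heatKer_mul_le d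
  refine ⟨M * (d + 1) * C, by positivity, fun ε hε hε1 => ?_⟩
  obtain ⟨χ, h1, h2, h3, h4, h5, h6⟩ := H ε hε hε1
  refine ⟨χ, h1, h2, h3, h4, fun T s hs hsT y => ?_⟩
  rw [lap_mul (contDiff_heatKer s) h1]
  by_cases hy : ‖y‖ < 1 / ε
  · have hev : χ =ᶠ[nhds y] fun _ => 1 := by
      filter_upwards [(isOpen_lt continuous_norm continuous_const).mem_nhds hy] with z hz
      exact h4 z hz
    have hz : ∀ i : Fin d, (fun z => fderiv ℝ χ z (EuclideanSpace.single i 1)) =ᶠ[nhds y]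
        fun _ => 0 := by
      intro i
      filter_upwards [hev.fderiv (𝕜 := ℝ)] with z hz
      rw [hz]
      simp
    have hL : Lap χ y = 0 := by
      refine Finset.sum_eq_zero fun i _ => ?_
      rw [(hz i).fderiv_eq]
      simp
    rw [hL, Finset.sum_eq_zero fun i _ => by rw [show fderiv ℝ χ y (EuclideanSpace.single i 1) = 0
      from (hz i).eq_of_nhds, mul_zero]]
    simp only [mul_zero, add_zero, sub_self, abs_zero]
    positivity
  · have hy1 : 1 ≤ ‖y‖ := ((one_le_div hε).2 hε1).trans (not_lt.1 hy)
    have hK := heatKer_pos s y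
    have h7 : ∀ i : Fin d, |fderiv ℝ (heatKer s) y (EuclideanSpace.single i 1)
        * fderiv ℝ χ y (EuclideanSpace.single i 1)|
        ≤ ‖y‖ / (2 * s) * heatKer s y * (ε * M) := by
      intro i
      rw [fderiv_heatKer, abs_mul, abs_mul, abs_neg, abs_div, abs_of_pos hK,
        abs_of_pos (by positivity : 0 < 2 * s)]
      gcongr
      · exact PiLp.norm_apply_le y i
      · exact h5 y i
    have h8 := (Finset.abs_sum_le_sum_abs (fun i : Fin d =>
      fderiv ℝ (heatKer s) y (EuclideanSpace.single i 1)
        * fderiv ℝ χ y (EuclideanSpace.single i 1)) Finset.univ).trans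
        (Finset.sum_le_sum fun i _ => h7 i)
    rw [Finset.sum_const, Finset.card_univ, Fintype.card_fin, nsmul_eq_mul] at h8
    have h9 : |heatKer s y * Lap χ y| ≤ heatKer s y * (ε * M) := by
      rw [abs_mul, abs_of_pos hK]
      gcongr
      exact h6 y
    have h10 := HC T s hs hsT y hy1
    set S := ∑ i, fderiv ℝ (heatKer s) y (EuclideanSpace.single i 1)
        * fderiv ℝ χ y (EuclideanSpace.single i 1)
    have h11 : 0 ≤ heatKer s y * (‖y‖ / s) := by positivity
    calc _ = |heatKer s y * Lap χ y + 2 * S| := by congr 1; ring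
      _ ≤ |heatKer s y * Lap χ y| + 2 * |S| := by
        refine (abs_add_le _ _).trans_eq ?_
        rw [abs_mul 2 S, abs_two]
      _ ≤ heatKer s y * (ε * M) + 2 * (d * (‖y‖ / (2 * s) * heatKer s y * (ε * M))) := by
        gcongr
      _ = ε * M * (heatKer s y + d * (heatKer s y * (‖y‖ / s))) := by field_simp
      _ ≤ ε * M * ((d + 1) * (heatKer s y * (‖y‖ / s + 1))) := by
        gcongr
        have : 0 ≤ (d : ℝ) * heatKer s y := by positivity
        nlinarith
      _ ≤ ε * M * ((d + 1) * (C * Real.exp (-(8 * T)⁻¹ * ‖y‖ ^ 2))) := by gcongr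
      _ = _ := by ring

theorem heatKer_smul {d : ℕ} {s : ℝ} (hs : 0 < s) (z : EuclideanSpace ℝ (Fin d)) :
    heatKer s (√s • z) = (√s ^ d)⁻¹ * Real.exp (-(1 / 4) * ‖z‖ ^ 2) := by
  have h1 : √s ^ d = Real.exp (d / 2 * Real.log s) := by
    rw [Real.sqrt_eq_rpow, ← Real.rpow_natCast, ← Real.rpow_mul hs.le, Real.rpow_def_of_pos hs]
    ring_nf
  rw [h1, ← Real.exp_neg, ← Real.exp_add, heatKer, norm_smul, mul_pow,
    Real.norm_of_nonneg (Real.sqrt_nonneg s), Real.sq_sqrt hs.le]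
  congr 1
  field_simp
  ring

/-- The heat kernel is an approximate identity. -/
theorem tendsto_integral_mul_heatKer {d : ℕ} {T : ℝ} (hT : 0 < T)
    {w : ℝ → EuclideanSpace ℝ (Fin d) → ℝ}
    (hc : ContinuousOn (fun p : ℝ × EuclideanSpace ℝ (Fin d) => w p.1 p.2)
      (Ico 0 T ×ˢ univ)) {C : ℝ} (hC : ∀ s ∈ Ico 0 T, ∀ y, |w s y| ≤ C) :
    Filter.Tendsto (fun s => ∫ y, w s y * heatKer s y) (nhdsWithin 0 (Ioi 0))
      (nhds (w 0 0 * ∫ z : EuclideanSpace ℝ (Fin d), Real.exp (-(1 / 4) * ‖z‖ ^ 2))) := by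
  have hIoo : Ioo 0 T ∈ nhdsWithin (0 : ℝ) (Ioi 0) := Ioo_mem_nhdsGT hT
  have hcov : ∀ s > 0, ∫ y, w s y * heatKer s y
      = ∫ z, w s (√s • z) * Real.exp (-(1 / 4) * ‖z‖ ^ 2) := by
    intro s hs
    have hs' : (√s ^ d) ≠ 0 := by positivity
    have h := MeasureTheory.Measure.integral_comp_smul MeasureTheory.volume
      (fun y : EuclideanSpace ℝ (Fin d) => w s y * heatKer s y) √s
    simp only [heatKer_smul hs, finrank_euclideanSpace, Fintype.card_fin, smul_eq_mul] at h
    rw [abs_of_nonneg (by positivity)] at h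
    have h2 : ∀ z, w s (√s • z) * ((√s ^ d)⁻¹ * Real.exp (-(1 / 4) * ‖z‖ ^ 2))
        = (√s ^ d)⁻¹ * (w s (√s • z) * Real.exp (-(1 / 4) * ‖z‖ ^ 2)) := fun z => by ring
    simp_rw [h2, MeasureTheory.integral_const_mul] at h
    exact (mul_left_cancel₀ (inv_ne_zero hs') h).symm
  rw [← MeasureTheory.integral_const_mul]
  refine Filter.Tendsto.congr' (f₁ := fun s => ∫ z, w s (√s • z)
    * Real.exp (-(1 / 4) * ‖z‖ ^ 2)) ?_ ?_
  · filter_upwards [hIoo] with s hs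
    exact (hcov s hs.1).symm
  refine MeasureTheory.tendsto_integral_filter_of_dominated_convergence
    (fun z => C * Real.exp (-(1 / 4) * ‖z‖ ^ 2)) ?_ ?_ ?_ ?_
  · filter_upwards [hIoo] with s hs
    have h1 : Continuous fun z : EuclideanSpace ℝ (Fin d) => w s (√s • z) := by
      rw [← continuousOn_univ]
      exact hc.comp (f := fun z => (s, √s • z)) (by fun_prop)
        fun y _ => ⟨⟨hs.1.le, hs.2⟩, mem_univ _⟩
    exact (h1.mul (by fun_prop)).aestronglyMeasurable
  · filter_upwards [hIoo] with s hs
    refine Filter.Eventually.of_forall fun z => ?_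
    rw [norm_mul, Real.norm_of_nonneg (Real.exp_pos _).le]
    gcongr
    exact hC s ⟨hs.1.le, hs.2⟩ _
  · exact (integrable_exp_neg_mul_norm_sq (by norm_num)).const_mul C
  · refine Filter.Eventually.of_forall fun z => ?_
    refine Filter.Tendsto.mul_const _ ?_
    have h0 : ContinuousWithinAt (fun p : ℝ × EuclideanSpace ℝ (Fin d) => w p.1 p.2)
      (Ico 0 T ×ˢ univ) (0, 0) := hc _ ⟨⟨le_rfl, hT⟩, mem_univ _⟩
    refine Filter.Tendsto.comp (f := fun s : ℝ => (s, √s • z)) h0 ?_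
    refine tendsto_nhdsWithin_iff.2 ⟨?_, ?_⟩
    · have : Continuous fun s : ℝ => (s, √s • z) := by fun_prop
      have h := this.tendsto 0
      simp only [Real.sqrt_zero, zero_smul] at h
      exact h.mono_left nhdsWithin_le_nhds
    · filter_upwards [hIoo] with s hs
      exact ⟨⟨hs.1.le, hs.2⟩, mem_univ _⟩

/-- The time derivative of a backward caloric function tested against a cut-off heat kernel. -/
theorem hasDerivAt_integral_mul_cutoff {d : ℕ} {T : ℝ}
    {v : ℝ → EuclideanSpace ℝ (Fin d) → ℝ}
    (hv : ContDiffOn ℝ (⊤ : ℕ∞) (fun p : ℝ × EuclideanSpace ℝ (Fin d) => v p.1 p.2)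
      (Ioo 0 T ×ˢ univ))
    (hpde : ∀ t ∈ Ioo 0 T, ∀ x, HasDerivAt (fun s => v s x) (-Lap (v t) x) t)
    {χ : EuclideanSpace ℝ (Fin d) → ℝ} (hχ : ContDiff ℝ (⊤ : ℕ∞) χ)
    (hχc : HasCompactSupport χ) {s : ℝ} (hs : s ∈ Ioo 0 T) :
    HasDerivAt (fun s => ∫ y, v s y * (heatKer s y * χ y))
      (-∫ y, v s y * (Lap (fun y => heatKer s y * χ y) y - Lap (heatKer s) y * χ y)) s := by
  have hslice : ∀ s ∈ Ioo 0 T, ContDiff ℝ (⊤ : ℕ∞) (v s) := by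
    intro s hs
    rw [← contDiffOn_univ]
    exact hv.comp (f := fun y => (s, y)) (by fun_prop) fun y _ => ⟨hs, mem_univ _⟩
  have hKc : ContinuousOn (fun p : ℝ × EuclideanSpace ℝ (Fin d) => heatKer p.1 p.2)
      (Ioo 0 T ×ˢ univ) := by
    unfold heatKer
    intro p hp
    have hp0 : p.1 ≠ 0 := hp.1.1.ne'
    have hp4 : 4 * p.1 ≠ 0 := mul_ne_zero four_ne_zero hp0
    refine ContinuousAt.continuousWithinAt ?_
    fun_prop (disch := assumption)
  have hd := hasDerivAt_integral_of_compact (I := Ioo 0 T) isOpen_Ioo hχc.isCompact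
    (f := fun s y => v s y * (heatKer s y * χ y))
    (f' := fun s y => (-Lap (v s) y) * (heatKer s y * χ y)
      + v s y * (Lap (heatKer s) y * χ y)) ?_ ?_ ?_ ?_ ?_ hs
  · refine hd.congr_deriv ?_
    have hKχ : ContDiff ℝ (⊤ : ℕ∞) fun y => heatKer s y * χ y := (contDiff_heatKer s).mul hχ
    have hKχc : HasCompactSupport fun y => heatKer s y * χ y := hχc.mul_left
    have i1 : MeasureTheory.Integrable fun y => Lap (v s) y * (heatKer s y * χ y) :=
      ((hslice s hs).lap.continuous.mul hKχ.continuous).integrable_of_hasCompactSupport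
        hKχc.mul_left
    have i1' : MeasureTheory.Integrable fun y => -(Lap (v s) y * (heatKer s y * χ y)) := i1.neg
    have i2 : MeasureTheory.Integrable fun y => v s y * (Lap (heatKer s) y * χ y) :=
      ((hslice s hs).continuous.mul ((contDiff_heatKer s).lap.continuous.mul
        hχ.continuous)).integrable_of_hasCompactSupport hχc.mul_left.mul_left
    have i3 : MeasureTheory.Integrable fun y => v s y * Lap (fun y => heatKer s y * χ y) y := by
      simp only [Lap, Finset.mul_sum]
      refine MeasureTheory.integrable_finsetSum _ fun i _ => ?_
      exact ((hslice s hs).continuous.mul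
        ((hKχ.fderiv_dir _).fderiv_dir _).continuous).integrable_of_hasCompactSupport
        ((hKχc.fderiv_apply ℝ _).fderiv_apply ℝ _).mul_left
    simp_rw [neg_mul, mul_sub]
    rw [MeasureTheory.integral_add i1' i2, MeasureTheory.integral_sub i3 i2,
      MeasureTheory.integral_neg, integral_lap_mul (hslice s hs) hKχ hKχc]
    ring
  · intro s hs
    exact (hslice s hs).continuous.mul ((contDiff_heatKer s).continuous.mul hχ.continuous)
  · have hLK : ContinuousOn (fun p : ℝ × EuclideanSpace ℝ (Fin d) => Lap (heatKer p.1) p.2)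
        (Ioo 0 T ×ˢ univ) := by
      simp only [lap_heatKer]
      refine ContinuousOn.mul (fun p hp => ?_) hKc
      have hp0 : p.1 ≠ 0 := hp.1.1.ne'
      have hp4 : 4 * p.1 ^ 2 ≠ 0 := mul_ne_zero four_ne_zero (pow_ne_zero _ hp0)
      refine ContinuousAt.continuousWithinAt ?_
      fun_prop (disch := assumption)
    have hχ' : ContinuousOn (fun p : ℝ × EuclideanSpace ℝ (Fin d) => χ p.2)
        (Ioo 0 T ×ˢ univ) := (hχ.continuous.comp continuous_snd).continuousOn
    exact ((hv.lap_slice_s2 isOpen_Ioo.uniqueDiffOn).continuousOn.neg.mul (hKc.mul hχ')).add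
      (hv.continuousOn.mul (hLK.mul hχ'))
  · intro s hs y
    exact (hpde s hs y).mul ((hasDerivAt_heatKer hs.1 y).mul_const (χ y))
  · intro s y hy
    simp only [image_eq_zero_of_notMem_tsupport hy, mul_zero]
  · intro s y hy
    simp only [image_eq_zero_of_notMem_tsupport hy, mul_zero, add_zero]

/-- The value of a backward caloric function of Gaussian growth is the heat-kernel average of its
values at a slightly later time. -/
theorem integral_mul_heatKer_eq {d : ℕ} {T T' : ℝ} (hT : 0 < T) (hTT' : T < T')
    {v : ℝ → EuclideanSpace ℝ (Fin d) → ℝ}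
    (hc : ContinuousOn (fun p : ℝ × EuclideanSpace ℝ (Fin d) => v p.1 p.2)
      (Ico 0 T' ×ˢ univ))
    (hv : ContDiffOn ℝ (⊤ : ℕ∞) (fun p : ℝ × EuclideanSpace ℝ (Fin d) => v p.1 p.2)
      (Ioo 0 T' ×ˢ univ))
    (hpde : ∀ t ∈ Ioo 0 T', ∀ x, HasDerivAt (fun s => v s x) (-Lap (v t) x) t)
    {B b : ℝ} (hb : 16 * b * T ≤ 1)
    (hg : ∀ s ∈ Ico 0 T', ∀ y, |v s y| ≤ B * Real.exp (b * ‖y‖ ^ 2)) :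
    ∫ y, v T y * heatKer T y
      = v 0 0 * ∫ z : EuclideanSpace ℝ (Fin d), Real.exp (-(1 / 4) * ‖z‖ ^ 2) := by
  have hT0 : T ∈ Ioo 0 T' := ⟨hT, hTT'⟩
  have hB : 0 ≤ B := by
    have := (abs_nonneg _).trans (hg T ⟨hT.le, hTT'⟩ 0)
    simpa using this
  have hb' : b ≤ (16 * T)⁻¹ := by
    rw [← one_div, le_div_iff₀ (by positivity)]
    linarith
  have hslice : ∀ s ∈ Ioo 0 T', Continuous (v s) := by
    intro s hs
    rw [← continuousOn_univ]
    exact hc.comp (f := fun y => (s, y)) (by fun_prop) fun y _ => ⟨⟨hs.1.le, hs.2⟩, mem_univ _⟩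
  have hgauss := integrable_exp_neg_mul_norm_sq (d := d) (b := (16 * T)⁻¹) (by positivity)
  obtain ⟨M, hM, H⟩ := exists_cutoff_heatKer d
  have hε : ∀ n : ℕ, (0 : ℝ) < 1 / (n + 1) ∧ (1 : ℝ) / (n + 1) ≤ 1 := fun n =>
    ⟨by positivity, by rw [div_le_one (by positivity)]; linarith [n.cast_nonneg (α := ℝ)]⟩
  choose χ hχ hχc hχ1 hχeq hχerr using fun n : ℕ => H (1 / (n + 1)) (hε n).1 (hε n).2
  set G := ∫ z : EuclideanSpace ℝ (Fin d), Real.exp (-(1 / 4) * ‖z‖ ^ 2) with hG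
  set N := ∫ z : EuclideanSpace ℝ (Fin d), Real.exp (-(16 * T)⁻¹ * ‖z‖ ^ 2) with hN
  have hN0 : 0 ≤ N := MeasureTheory.integral_nonneg fun z => (Real.exp_pos _).le
  have hbound : ∀ n, ∀ s ∈ Ioc 0 T, |∫ y, v s y * (Lap (fun y => heatKer s y * χ n y) y
      - Lap (heatKer s) y * χ n y)| ≤ B * (1 / (n + 1) * M) * N := by
    intro n s hs
    rw [hN, ← MeasureTheory.integral_const_mul, ← Real.norm_eq_abs]
    refine MeasureTheory.norm_integral_le_of_norm_le (hgauss.const_mul _)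
      (Filter.Eventually.of_forall fun y => ?_)
    rw [norm_mul]
    refine (mul_le_mul (hg s ⟨hs.1.le, hs.2.trans_lt hTT'⟩ y) (hχerr n T s hs.1 hs.2 y)
      (abs_nonneg _) (by positivity)).trans ?_
    have : Real.exp (b * ‖y‖ ^ 2) * Real.exp (-(8 * T)⁻¹ * ‖y‖ ^ 2)
        ≤ Real.exp (-(16 * T)⁻¹ * ‖y‖ ^ 2) := by
      rw [← Real.exp_add, ← add_mul]
      refine Real.exp_le_exp.2 (mul_le_mul_of_nonneg_right ?_ (sq_nonneg _))
      have : (8 * T)⁻¹ = (16 * T)⁻¹ + (16 * T)⁻¹ := by field_simp; norm_num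
      linarith
    calc _ = B * (1 / (n + 1) * M) * (Real.exp (b * ‖y‖ ^ 2)
          * Real.exp (-(8 * T)⁻¹ * ‖y‖ ^ 2)) := by ring
      _ ≤ _ := by gcongr
  have hmvt : ∀ n, ∀ s ∈ Ioc 0 T, |(∫ y, v s y * (heatKer s y * χ n y))
      - ∫ y, v T y * (heatKer T y * χ n y)| ≤ B * (1 / (n + 1) * M) * N * T := by
    intro n s hs
    have h := (convex_Ioc 0 T).norm_image_sub_le_of_norm_hasDerivWithin_le
      (f := fun s => ∫ y, v s y * (heatKer s y * χ n y))
      (C := B * (1 / (n + 1) * M) * N)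
      (fun s hs => (hasDerivAt_integral_mul_cutoff hv hpde (hχ n) (hχc n)
        ⟨hs.1, hs.2.trans_lt hTT'⟩).hasDerivWithinAt)
      (fun s hs => by rw [norm_neg]; exact hbound n s hs) (right_mem_Ioc.2 hT) hs
    refine h.trans ?_
    gcongr
    rw [Real.norm_eq_abs, abs_le]
    constructor <;> linarith [hs.1, hs.2]
  have hlim0 : ∀ n, |v 0 0 * G - ∫ y, v T y * (heatKer T y * χ n y)|
      ≤ B * (1 / (n + 1) * M) * N * T := by
    intro n
    have hχ0 : χ n 0 = 1 := hχeq n 0 (by rw [norm_zero]; exact one_div_pos.2 (hε n).1)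
    obtain ⟨R, hR⟩ := (hχc n).isCompact.isBounded.exists_norm_le
    have ht := tendsto_integral_mul_heatKer (hT.trans hTT') (w := fun s y => v s y * χ n y)
      (C := B * Real.exp (|b| * R ^ 2))
      (hc.mul ((hχ n).continuous.comp continuous_snd).continuousOn) (by
        intro s hs y
        by_cases hy : y ∈ tsupport (χ n)
        · rw [abs_mul]
          refine (mul_le_of_le_one_right (abs_nonneg _) (hχ1 n y)).trans ((hg s hs y).trans ?_)
          have := hR y hy
          gcongr
          exact le_abs_self b
        · rw [image_eq_zero_of_notMem_tsupport hy, mul_zero, abs_zero]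
          positivity)
    rw [hχ0, mul_one, ← hG] at ht
    refine le_of_tendsto (ht.sub_const _).abs ?_
    filter_upwards [Ioc_mem_nhdsGT hT] with s hs
    refine le_of_eq_of_le ?_ (hmvt n s hs)
    congr! 4 with y
    ring
  have hlim1 : Filter.Tendsto (fun n => ∫ y, v T y * (heatKer T y * χ n y)) Filter.atTop
      (nhds (∫ y, v T y * heatKer T y)) := by
    refine MeasureTheory.tendsto_integral_of_dominated_convergence
      (fun y => B * Real.exp (-(d / 2) * Real.log T) * Real.exp (-(16 * T)⁻¹ * ‖y‖ ^ 2))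
      ?_ (hgauss.const_mul _) ?_ ?_
    · intro n
      exact ((hslice T hT0).mul ((contDiff_heatKer T).continuous.mul
        (hχ n).continuous)).aestronglyMeasurable
    · intro n
      refine Filter.Eventually.of_forall fun y => ?_
      rw [norm_mul, norm_mul, Real.norm_of_nonneg (heatKer_pos T y).le]
      calc ‖v T y‖ * (heatKer T y * ‖χ n y‖)
          ≤ (B * Real.exp (b * ‖y‖ ^ 2)) * (heatKer T y * 1) := by
            have := (heatKer_pos T y).le
            gcongr
            · exact hg T ⟨hT.le, hTT'⟩ y
            · exact hχ1 n y
        _ = B * Real.exp (-(d / 2) * Real.log T + (b * ‖y‖ ^ 2 - ‖y‖ ^ 2 / (4 * T))) := by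
            rw [heatKer, mul_one, mul_assoc, ← Real.exp_add]
            ring_nf
        _ ≤ B * Real.exp (-(d / 2) * Real.log T + (-(16 * T)⁻¹ * ‖y‖ ^ 2)) := by
            gcongr
            have h1 : ‖y‖ ^ 2 / (4 * T) = 4 * ((16 * T)⁻¹ * ‖y‖ ^ 2) := by field_simp; norm_num
            have h2 : 0 ≤ (16 * T)⁻¹ * ‖y‖ ^ 2 := by positivity
            nlinarith [mul_le_mul_of_nonneg_right hb' (sq_nonneg ‖y‖)]
        _ = _ := by rw [Real.exp_add, mul_assoc]
    · refine Filter.Eventually.of_forall fun y => ?_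
      refine tendsto_const_nhds.congr' ?_
      filter_upwards [Filter.eventually_gt_atTop ⌈‖y‖⌉₊] with n hn
      rw [hχeq n y, mul_one]
      rw [one_div_one_div]
      have := Nat.lt_of_ceil_lt hn
      linarith
  have hlim2 : Filter.Tendsto (fun n : ℕ => B * (1 / ((n : ℝ) + 1) * M) * N * T) Filter.atTop
      (nhds 0) := by
    have := (((tendsto_one_div_add_atTop_nhds_zero_nat (𝕜 := ℝ)).mul_const M).const_mul B
      |>.mul_const N).mul_const T
    simpa using this
  have h := le_of_tendsto_of_tendsto' (hlim1.const_sub (v 0 0 * G)).abs hlim2 hlim0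
  linarith [abs_nonpos_iff.1 h]

/-- The heat kernel at complex times. -/
noncomputable def cheatKer {d : ℕ} (w : ℂ) (y : EuclideanSpace ℝ (Fin d)) : ℂ :=
  Complex.exp (-(d / 2) * Complex.log w - ((‖y‖ ^ 2 : ℝ) : ℂ) / (4 * w))

theorem cheatKer_ofReal {d : ℕ} {s : ℝ} (hs : 0 < s) (y : EuclideanSpace ℝ (Fin d)) :
    cheatKer (s : ℂ) y = (heatKer s y : ℂ) := by
  rw [cheatKer, heatKer, ← Complex.ofReal_log hs.le]
  push_cast
  rfl

theorem continuous_cheatKer {d : ℕ} (w : ℂ) :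
    Continuous (cheatKer w : EuclideanSpace ℝ (Fin d) → ℂ) := by
  unfold cheatKer
  fun_prop

theorem re_norm_of_mem_ball {T : ℝ} {z : ℂ} (hz : z ∈ Metric.ball (0 : ℂ) (T / 2)) :
    T / 2 ≤ ((T : ℂ) - z).re ∧ ‖(T : ℂ) - z‖ ≤ 3 * T / 2 := by
  rw [mem_ball_zero_iff] at hz
  have hT : 0 < T := by linarith [norm_nonneg z]
  constructor
  · have := (le_abs_self _).trans (Complex.abs_re_le_norm z)
    simp only [Complex.sub_re, Complex.ofReal_re]
    linarith
  · refine (norm_sub_le _ _).trans ?_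
    rw [Complex.norm_real, Real.norm_of_nonneg hT.le]
    linarith

theorem norm_cheatKer_le {d : ℕ} {T : ℝ} (hT : 0 < T) {z : ℂ}
    (hz : z ∈ Metric.ball (0 : ℂ) (T / 2)) (y : EuclideanSpace ℝ (Fin d)) :
    ‖cheatKer ((T : ℂ) - z) y‖
      ≤ Real.exp (-(d / 2) * Real.log (T / 2)) * Real.exp (-(18 * T)⁻¹ * ‖y‖ ^ 2) := by
  obtain ⟨h1, h2⟩ := re_norm_of_mem_ball hz
  set w := (T : ℂ) - z
  have h3 : T / 2 ≤ ‖w‖ := h1.trans ((le_abs_self _).trans (Complex.abs_re_le_norm w))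
  have hw : 0 < ‖w‖ := by linarith
  rw [cheatKer, Complex.norm_exp, ← Real.exp_add]
  refine Real.exp_le_exp.2 ?_
  have h4 : (-(d / 2 : ℂ) * Complex.log w).re = -(d / 2) * Real.log ‖w‖ := by
    rw [show (-(d / 2 : ℂ)) = ((-(d / 2) : ℝ) : ℂ) by push_cast; rfl, Complex.re_ofReal_mul,
      Complex.log_re]
  have h5 : (((‖y‖ ^ 2 : ℝ) : ℂ) / (4 * w)).re = ‖y‖ ^ 2 / 4 * (w.re / ‖w‖ ^ 2) := by
    rw [show ((‖y‖ ^ 2 : ℝ) : ℂ) / (4 * w) = ((‖y‖ ^ 2 / 4 : ℝ) : ℂ) * w⁻¹ by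
      push_cast; rw [div_mul_eq_div_div, div_eq_mul_inv], Complex.re_ofReal_mul, Complex.inv_re,
      Complex.normSq_eq_norm_sq]
  have h6 : Real.log (T / 2) ≤ Real.log ‖w‖ := Real.log_le_log (by positivity) h3
  have h7 : 4 * (18 * T)⁻¹ ≤ w.re / ‖w‖ ^ 2 := by
    rw [le_div_iff₀ (by positivity)]
    calc 4 * (18 * T)⁻¹ * ‖w‖ ^ 2 ≤ 4 * (18 * T)⁻¹ * (3 * T / 2) ^ 2 := by gcongr
      _ = T / 2 := by field_simp; norm_num
      _ ≤ _ := h1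
  rw [Complex.sub_re, h4, h5]
  have h8 : (0 : ℝ) ≤ d / 2 := by positivity
  nlinarith [mul_le_mul_of_nonneg_left h6 h8, mul_le_mul_of_nonneg_left h7 (sq_nonneg ‖y‖)]

theorem hasDerivAt_cheatKer {d : ℕ} {T : ℝ} (hT : 0 < T) {z : ℂ}
    (hz : z ∈ Metric.ball (0 : ℂ) (T / 2)) (y : EuclideanSpace ℝ (Fin d)) :
    HasDerivAt (fun z : ℂ => cheatKer ((T : ℂ) - z) y)
      (cheatKer ((T : ℂ) - z) y
        * ((d / 2) * ((T : ℂ) - z)⁻¹ - ((‖y‖ ^ 2 : ℝ) : ℂ) / 4 * (((T : ℂ) - z) ^ 2)⁻¹)) z := by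
  obtain ⟨h1, -⟩ := re_norm_of_mem_ball hz
  have hre : 0 < ((T : ℂ) - z).re := by linarith
  have hne : (T : ℂ) - z ≠ 0 := fun h => by simp [h] at hre
  have hne4 : 4 * ((T : ℂ) - z) ≠ 0 := mul_ne_zero (by norm_num) hne
  have h0 : HasDerivAt (fun z : ℂ => (T : ℂ) - z) (-1) z := (hasDerivAt_id' z).const_sub _
  have h2 := ((h0.clog (Or.inl hre)).const_mul (-(d / 2 : ℂ))).fun_sub
    ((hasDerivAt_const z ((‖y‖ ^ 2 : ℝ) : ℂ)).fun_div (h0.const_mul (4 : ℂ))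
      hne4) |>.cexp
  refine h2.congr_deriv ?_
  rw [← cheatKer]
  congr 1
  field_simp
  ring

/-- The heat-kernel average of a function of Gaussian growth is bounded and holomorphic in time. -/
theorem differentiableOn_integral_cheatKer {d : ℕ} {T : ℝ} (hT : 0 < T)
    {g : EuclideanSpace ℝ (Fin d) → ℝ} (hg : Continuous g) {B b : ℝ}
    (hb : 36 * b * T ≤ 1) (hgB : ∀ y, |g y| ≤ B * Real.exp (b * ‖y‖ ^ 2)) :
    DifferentiableOn ℂ (fun z : ℂ => ∫ y, (g y : ℂ) * cheatKer ((T : ℂ) - z) y)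
      (Metric.ball 0 (T / 2)) ∧
    ∀ z ∈ Metric.ball (0 : ℂ) (T / 2), ‖∫ y, (g y : ℂ) * cheatKer ((T : ℂ) - z) y‖
      ≤ B * (Real.exp (-(d / 2) * Real.log (T / 2))
        * ∫ y : EuclideanSpace ℝ (Fin d), Real.exp (-(36 * T)⁻¹ * ‖y‖ ^ 2)) := by
  have hB : 0 ≤ B := by
    have := (abs_nonneg _).trans (hgB 0)
    simpa using this
  have hb' : b ≤ (36 * T)⁻¹ := by
    rw [← one_div, le_div_iff₀ (by positivity)]
    linarith
  set D := Real.exp (-(d / 2) * Real.log (T / 2)) with hD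
  have hnorm : ∀ z ∈ Metric.ball (0 : ℂ) (T / 2), ∀ y,
      ‖(g y : ℂ) * cheatKer ((T : ℂ) - z) y‖ ≤ B * D * Real.exp (-(36 * T)⁻¹ * ‖y‖ ^ 2) := by
    intro z hz y
    rw [norm_mul, Complex.norm_real]
    calc ‖g y‖ * ‖cheatKer ((T : ℂ) - z) y‖
        ≤ (B * Real.exp (b * ‖y‖ ^ 2)) * (D * Real.exp (-(18 * T)⁻¹ * ‖y‖ ^ 2)) :=
          mul_le_mul (hgB y) (norm_cheatKer_le hT hz y) (norm_nonneg _) (by positivity)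
      _ = B * D * Real.exp ((b - (18 * T)⁻¹) * ‖y‖ ^ 2) := by
          rw [sub_mul, sub_eq_add_neg, Real.exp_add, neg_mul]
          ring
      _ ≤ _ := by
          gcongr
          have : (18 * T)⁻¹ = (36 * T)⁻¹ + (36 * T)⁻¹ := by field_simp; norm_num
          linarith
  have hcont : ∀ z : ℂ, Continuous fun y => (g y : ℂ) * cheatKer ((T : ℂ) - z) y := fun z =>
    (Complex.continuous_ofReal.comp hg).mul (continuous_cheatKer _)
  have hint := integrable_exp_neg_mul_norm_sq (d := d) (b := (36 * T)⁻¹) (by positivity)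
  constructor
  · intro z hz
    refine DifferentiableAt.differentiableWithinAt ?_
    refine (hasDerivAt_integral_of_dominated_loc_of_deriv_le
      (F' := fun z y => (g y : ℂ) * (cheatKer ((T : ℂ) - z) y
        * ((d / 2) * ((T : ℂ) - z)⁻¹ - ((‖y‖ ^ 2 : ℝ) : ℂ) / 4 * (((T : ℂ) - z) ^ 2)⁻¹)))
      (bound := fun y => B * D * (d / T + 72 / T) * Real.exp (-(72 * T)⁻¹ * ‖y‖ ^ 2))
      (Metric.isOpen_ball.mem_nhds hz) ?_ ?_ ?_ ?_ ?_ ?_).2.differentiableAt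
    · exact Filter.Eventually.of_forall fun z => (hcont z).aestronglyMeasurable
    · exact (hint.const_mul (B * D)).mono' (hcont z).aestronglyMeasurable
        (Filter.Eventually.of_forall (hnorm z hz))
    · refine Continuous.aestronglyMeasurable ?_
      have := continuous_cheatKer (d := d) ((T : ℂ) - z)
      fun_prop
    · refine Filter.Eventually.of_forall fun y z hz => ?_
      obtain ⟨h1, -⟩ := re_norm_of_mem_ball hz
      have h3 : T / 2 ≤ ‖(T : ℂ) - z‖ :=
        h1.trans ((le_abs_self _).trans (Complex.abs_re_le_norm _))
      have h4 : ‖(d / 2 : ℂ) * ((T : ℂ) - z)⁻¹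
          - ((‖y‖ ^ 2 : ℝ) : ℂ) / 4 * (((T : ℂ) - z) ^ 2)⁻¹‖ ≤ d / T + ‖y‖ ^ 2 / T ^ 2 := by
        refine (norm_sub_le _ _).trans ?_
        rw [norm_mul, norm_mul, norm_inv, norm_inv, norm_pow, norm_div, norm_div,
          Complex.norm_real, Real.norm_of_nonneg (sq_nonneg _), Complex.norm_natCast]
        simp only [Complex.norm_ofNat]
        calc (d / 2 : ℝ) * ‖(T : ℂ) - z‖⁻¹ + ‖y‖ ^ 2 / 4 * (‖(T : ℂ) - z‖ ^ 2)⁻¹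
            ≤ (d / 2 : ℝ) * (T / 2)⁻¹ + ‖y‖ ^ 2 / 4 * ((T / 2) ^ 2)⁻¹ := by gcongr
          _ = _ := by field_simp; ring
      have h5 : ‖y‖ ^ 2 / T ^ 2 ≤ 72 / T * Real.exp ((72 * T)⁻¹ * ‖y‖ ^ 2) := by
        have := Real.add_one_le_exp ((72 * T)⁻¹ * ‖y‖ ^ 2)
        calc ‖y‖ ^ 2 / T ^ 2 = 72 / T * ((72 * T)⁻¹ * ‖y‖ ^ 2) := by field_simp
          _ ≤ _ := by gcongr; linarith
      have h6 : (d / T : ℝ) ≤ d / T * Real.exp ((72 * T)⁻¹ * ‖y‖ ^ 2) :=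
        le_mul_of_one_le_right (by positivity) (Real.one_le_exp (by positivity))
      rw [← mul_assoc, norm_mul]
      calc _ ≤ (B * D * Real.exp (-(36 * T)⁻¹ * ‖y‖ ^ 2))
            * ((d / T + 72 / T) * Real.exp ((72 * T)⁻¹ * ‖y‖ ^ 2)) := by
            refine mul_le_mul (hnorm z hz y) (h4.trans ?_) (norm_nonneg _) (by positivity)
            linarith
        _ = B * D * (d / T + 72 / T) * (Real.exp (-(36 * T)⁻¹ * ‖y‖ ^ 2)
            * Real.exp ((72 * T)⁻¹ * ‖y‖ ^ 2)) := by ring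
        _ = _ := by
            rw [← Real.exp_add]
            congr 2
            field_simp
            ring
    · exact (integrable_exp_neg_mul_norm_sq (by positivity)).const_mul _
    · exact Filter.Eventually.of_forall fun y z hz =>
        (hasDerivAt_cheatKer hT hz y).const_mul _
  · intro z hz
    rw [← mul_assoc, ← MeasureTheory.integral_const_mul]
    exact MeasureTheory.norm_integral_le_of_norm_le (hint.const_mul _)
      (Filter.Eventually.of_forall (hnorm z hz))

theorem lap_comp_add_left {d : ℕ} (f : EuclideanSpace ℝ (Fin d) → ℝ)
    (x y : EuclideanSpace ℝ (Fin d)) : Lap (fun y => f (x + y)) y = Lap f (x + y) := by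
  unfold Lap
  simp_rw [fderiv_comp_add_left]
  refine Finset.sum_congr rfl fun i _ => ?_
  rw [fderiv_comp_add_left (f := fun y => fderiv ℝ f y (EuclideanSpace.single i 1))]

/-- Complex derivatives at real points of a holomorphic function that is real on an interval. -/
theorem iteratedDeriv_eq_of_hasDerivAt {U : Set ℂ} (hU : IsOpen U) {F : ℂ → ℂ}
    (hF : DifferentiableOn ℂ F U) {I : Set ℝ} (hI : IsOpen I) (hIU : ∀ t ∈ I, (t : ℂ) ∈ U)
    {w : ℕ → ℝ → ℝ} (h0 : ∀ t ∈ I, F t = w 0 t)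
    (hw : ∀ j, ∀ t ∈ I, HasDerivAt (w j) (w (j + 1) t) t) (j : ℕ) :
    ∀ t ∈ I, iteratedDeriv j F t = w j t := by
  induction j with
  | zero => simpa using h0
  | succ j ih =>
    intro t ht
    rw [iteratedDeriv_succ]
    have hd : DifferentiableAt ℂ (iteratedDeriv j F) t := by
      rw [iteratedDeriv_eq_iterate]
      exact (((hF.analyticOnNhd hU) t (hIU t ht)).iterated_deriv j).differentiableAt
    have h1 : HasDerivAt (fun s : ℝ => iteratedDeriv j F s) _ t := hd.hasDerivAt.comp_ofReal
    have h2 : HasDerivAt (fun s : ℝ => ((w j s : ℝ) : ℂ)) _ t := (hw j t ht).ofReal_comp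
    refine h1.unique (h2.congr_of_eventuallyEq ?_)
    filter_upwards [hI.mem_nhds ht] with s hs
    exact ih s hs

/-- Derivative bounds, away from the initial time, for backward caloric functions of Gaussian
growth. -/
theorem exists_abs_iterate_lap_le {d : ℕ} {δ : ℝ} (hδ : 0 < δ)
    {u : ℝ → EuclideanSpace ℝ (Fin d) → ℝ}
    (hu : ContDiffOn ℝ (⊤ : ℕ∞) (fun p : ℝ × EuclideanSpace ℝ (Fin d) => u p.1 p.2)
      (Ioo 0 δ ×ˢ univ))
    (hpde : ∀ j, ∀ t ∈ Ioo 0 δ, ∀ x,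
      HasDerivAt (fun s => Lap^[j] (u s) x) (-Lap^[j + 1] (u t) x) t)
    {A₁ A₂ : ℝ} (hA₁ : 0 < A₁) (hA₂ : 0 < A₂)
    (hgrow : ∀ t ∈ Ioo 0 δ, ∀ x, |u t x| ≤ A₁ * Real.exp (A₂ * ‖x‖ ^ 2)) :
    ∃ C > (0 : ℝ), ∃ q > (0 : ℝ), ∃ τ > (0 : ℝ), ∀ t ∈ Ioo 0 τ, ∀ j x,
      |Lap^[j] (u t) x| ≤ C * q ^ j * j.factorial * Real.exp (2 * A₂ * ‖x‖ ^ 2) := by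
  obtain ⟨T, hT, hTδ, hTA⟩ : ∃ T > 0, T < δ ∧ 72 * A₂ * T ≤ 1 := by
    refine ⟨min (δ / 2) (1 / (72 * A₂)), by positivity,
      (min_le_left _ _).trans_lt (by linarith), ?_⟩
    calc 72 * A₂ * min (δ / 2) (1 / (72 * A₂)) ≤ 72 * A₂ * (1 / (72 * A₂)) := by
          gcongr
          exact min_le_right _ _
      _ = 1 := by field_simp
  have hshift : ∀ t ∈ Ioo 0 δ, ∀ x y, |u t (x + y)|
      ≤ A₁ * Real.exp (2 * A₂ * ‖x‖ ^ 2) * Real.exp (2 * A₂ * ‖y‖ ^ 2) := by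
    intro t ht x y
    refine (hgrow t ht (x + y)).trans ?_
    rw [mul_assoc, ← Real.exp_add]
    gcongr
    have h1 : ‖x + y‖ ^ 2 ≤ 2 * ‖x‖ ^ 2 + 2 * ‖y‖ ^ 2 := by
      have := pow_le_pow_left₀ (norm_nonneg _) (norm_add_le x y) 2
      nlinarith [sq_nonneg (‖x‖ - ‖y‖)]
    nlinarith
  set G := ∫ z : EuclideanSpace ℝ (Fin d), Real.exp (-(1 / 4) * ‖z‖ ^ 2) with hG
  have hG0 : 0 < G := MeasureTheory.integral_exp_pos (integrable_exp_neg_mul_norm_sq (by norm_num))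
  set K := Real.exp (-(d / 2) * Real.log (T / 2))
    * ∫ y : EuclideanSpace ℝ (Fin d), Real.exp (-(36 * T)⁻¹ * ‖y‖ ^ 2) with hK
  have hK0 : 0 < K := mul_pos (Real.exp_pos _)
    (MeasureTheory.integral_exp_pos (integrable_exp_neg_mul_norm_sq (by positivity)))
  refine ⟨A₁ * K / G, by positivity, 4 / T, by positivity, T / 4, by positivity, ?_⟩
  intro t ht j x
  set B := A₁ * Real.exp (2 * A₂ * ‖x‖ ^ 2) with hB
  have hrep : ∀ t ∈ Ioo 0 T, ∫ y, u T (x + y) * heatKer (T - t) y = u t x * G := by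
    intro t ht
    have hmaps : MapsTo (fun p : ℝ × EuclideanSpace ℝ (Fin d) => (t + p.1, x + p.2))
        (Ico 0 (δ - t) ×ˢ univ) (Ioo 0 δ ×ˢ univ) := fun p hp =>
      ⟨⟨by linarith [hp.1.1, ht.1], by linarith [hp.1.2]⟩, mem_univ _⟩
    have h := integral_mul_heatKer_eq (T := T - t) (T' := δ - t) (b := 2 * A₂) (B := B)
      (v := fun s y => u (t + s) (x + y)) (by linarith [ht.2]) (by linarith)
      (hu.continuousOn.comp (by fun_prop) hmaps)
      (hu.comp (f := fun p : ℝ × EuclideanSpace ℝ (Fin d) => (t + p.1, x + p.2)) (by fun_prop)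
        (hmaps.mono_left (prod_mono Ioo_subset_Ico_self subset_rfl)))
      (by
        intro s hs y
        rw [lap_comp_add_left]
        exact HasDerivAt.comp_const_add t s (hpde 0 (t + s)
          ⟨by linarith [hs.1, ht.1], by linarith [hs.2]⟩ (x + y)))
      (by nlinarith [ht.1])
      (fun s hs y => hshift _ ⟨by linarith [hs.1, ht.1], by linarith [hs.2]⟩ x y)
    rw [← hG] at h
    simpa using h
  have hslice : Continuous fun y => u T (x + y) := by
    rw [← continuousOn_univ]
    exact hu.continuousOn.comp (f := fun y => (T, x + y)) (by fun_prop)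
      fun y _ => ⟨⟨hT, hTδ⟩, mem_univ _⟩
  obtain ⟨hF, hFb⟩ := differentiableOn_integral_cheatKer hT hslice (b := 2 * A₂) (B := B)
    (by linarith) (hshift T ⟨hT, hTδ⟩ x)
  set F := fun z : ℂ => ∫ y, ((u T (x + y) : ℝ) : ℂ) * cheatKer ((T : ℂ) - z) y with hFdef
  have hIU : ∀ t ∈ Ioo 0 (T / 2), (t : ℂ) ∈ Metric.ball (0 : ℂ) (T / 2) := by
    intro t ht
    rw [mem_ball_zero_iff, Complex.norm_real, Real.norm_of_nonneg ht.1.le]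
    exact ht.2
  have hder := iteratedDeriv_eq_of_hasDerivAt Metric.isOpen_ball hF isOpen_Ioo hIU
    (w := fun j t => (-1) ^ j * Lap^[j] (u t) x * G) (by
      intro t ht
      have htT : 0 < T - t := by linarith [ht.2]
      have h1 : ∀ y : EuclideanSpace ℝ (Fin d), ((u T (x + y) : ℝ) : ℂ)
          * cheatKer ((T : ℂ) - t) y = ((u T (x + y) * heatKer (T - t) y : ℝ) : ℂ) := by
        intro y
        rw [← Complex.ofReal_sub, cheatKer_ofReal htT, Complex.ofReal_mul]
      simp only [hFdef, h1, integral_complex_ofReal]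
      rw [hrep t ⟨ht.1, by linarith [ht.2]⟩]
      simp) (by
      intro j t ht
      refine (((hpde j t ⟨ht.1, by linarith [ht.2]⟩ x).const_mul ((-1) ^ j)).mul_const
        G).congr_deriv ?_
      rw [pow_succ]
      ring) j t ⟨ht.1, by linarith [ht.2]⟩
  have hsub : Metric.closedBall (t : ℂ) (T / 4) ⊆ Metric.ball 0 (T / 2) := by
    refine Metric.closedBall_subset_ball' ?_
    rw [dist_zero_right, Complex.norm_real, Real.norm_of_nonneg ht.1.le]
    linarith [ht.2]
  have hcauchy := Complex.norm_iteratedDeriv_le_of_forall_mem_sphere_norm_le (c := (t : ℂ))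
    (F := ℂ) (f := F) j (by positivity : 0 < T / 4)
    (hF.diffContOnCl_ball hsub)
    (fun z hz => hFb z (hsub (Metric.sphere_subset_closedBall hz)))
  rw [← hK, hder, Complex.norm_real, norm_mul, norm_mul, norm_pow, norm_neg, norm_one, one_pow, one_mul,
    Real.norm_of_nonneg hG0.le, ← le_div_iff₀ hG0] at hcauchy
  refine hcauchy.trans_eq ?_
  rw [hB, div_pow, div_pow]
  field_simp

/-- **Necessity part of the solvability criterion for the backward heat equation.**
If the Cauchy problem `∂ₜu + Δu = 0`, `u(0,·) = a` has a smooth solution on `[0,δ) × ℝ^d`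
(for some `δ > 0`) of exponential growth of order 2, then there are positive constants
`A₃, A₄` with `|Δʲ a(x)| ≤ A₃^{j+1} jʲ exp(A₄ |x|²)` for all `j ≥ 0` and all `x`. -/
theorem backward_heat_necessary (d : ℕ) (a : EuclideanSpace ℝ (Fin d) → ℝ)
    (ha : ContDiff ℝ (⊤ : ℕ∞) a)
    (δ : ℝ) (hδ : 0 < δ) (u : ℝ → EuclideanSpace ℝ (Fin d) → ℝ)
    (hsm : ContDiffOn ℝ (⊤ : ℕ∞) (fun p : ℝ × EuclideanSpace ℝ (Fin d) => u p.1 p.2)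
      (Set.Ico 0 δ ×ˢ (Set.univ : Set (EuclideanSpace ℝ (Fin d)))))
    (hpde : ∀ t ∈ Set.Ioo (0:ℝ) δ, ∀ x, deriv (fun s => u s x) t + Lap (u t) x = 0)
    (hinit : ∀ x, u 0 x = a x)
    (A₁ A₂ : ℝ) (hA₁ : 0 < A₁) (hA₂ : 0 < A₂)
    (hgrow : ∀ t ∈ Set.Ico (0:ℝ) δ, ∀ x, |u t x| ≤ A₁ * Real.exp (A₂ * ‖x‖^2)) :
    ∃ A₃ > (0:ℝ), ∃ A₄ > (0:ℝ), ∀ (j : ℕ) (x),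
      |Lap^[j] a x| ≤ A₃^(j+1) * (j:ℝ)^j * Real.exp (A₄ * ‖x‖^2) := by
  have hsub : Ioo 0 δ ×ˢ (univ : Set (EuclideanSpace ℝ (Fin d))) ⊆ Ico 0 δ ×ˢ univ :=
    prod_mono Ioo_subset_Ico_self subset_rfl
  have hsmooth : ∀ j, ContDiffOn ℝ (⊤ : ℕ∞)
      (fun p : ℝ × EuclideanSpace ℝ (Fin d) => Lap^[j] (u p.1) p.2) (Ico 0 δ ×ˢ univ) := by
    intro j
    induction j with
    | zero => exact hsm
    | succ j ih =>
      simp only [Function.iterate_succ_apply']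
      exact ih.lap_slice_s2 (w := fun t => Lap^[j] (u t)) (uniqueDiffOn_Ico 0 δ)
  have hevol : ∀ j, ∀ t ∈ Ioo 0 δ, ∀ x,
      HasDerivAt (fun s => Lap^[j] (u s) x) (-Lap^[j + 1] (u t) x) t := by
    intro j
    induction j with
    | zero =>
      intro t ht x
      have hdiff : DifferentiableAt ℝ (fun s => u s x) t := by
        have h := ((hsm.mono hsub).contDiffAt ((isOpen_Ioo.prod isOpen_univ).mem_nhds
          (⟨ht, mem_univ x⟩ : (t, x) ∈ Ioo 0 δ ×ˢ univ))).differentiableAt (by simp)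
        exact h.comp (f := fun s => (s, x)) t (by fun_prop)
      have h := hdiff.hasDerivAt
      rw [eq_neg_of_add_eq_zero_left (hpde t ht x)] at h
      exact h
    | succ j ih =>
      intro t ht x
      simp only [Function.iterate_succ_apply'] at ih ⊢
      exact hasDerivAt_lap_slice (w := fun t => Lap^[j] (u t)) isOpen_Ioo
        ((hsmooth j).mono hsub) ih ht x
  obtain ⟨C, hC, q, hq, τ, hτ, H⟩ := exists_abs_iterate_lap_le hδ (hsm.mono hsub) hevol hA₁ hA₂
    fun t ht => hgrow t (Ioo_subset_Ico_self ht)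
  refine ⟨max C q, lt_max_of_lt_left hC, 2 * A₂, by positivity, fun j x => ?_⟩
  have hlim : Filter.Tendsto (fun t => Lap^[j] (u t) x) (nhdsWithin 0 (Ioo 0 δ))
      (nhds (Lap^[j] (u 0) x)) := by
    refine Filter.Tendsto.comp (f := fun t : ℝ => (t, x))
      ((hsmooth j).continuousOn (0, x) ⟨left_mem_Ico.2 hδ, mem_univ _⟩)
      (tendsto_nhdsWithin_iff.2 ⟨?_, ?_⟩)
    · exact (by fun_prop : Continuous fun t : ℝ => (t, x)).tendsto 0 |>.mono_left
        nhdsWithin_le_nhds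
    · filter_upwards [self_mem_nhdsWithin] with t ht
      exact ⟨Ioo_subset_Ico_self ht, mem_univ _⟩
  rw [nhdsWithin_Ioo_eq_nhdsGT hδ, funext hinit] at hlim
  refine le_of_tendsto hlim.abs ?_
  filter_upwards [Ioo_mem_nhdsGT hτ] with t ht
  refine (H t ht j x).trans ?_
  have hfac : (j.factorial : ℝ) ≤ (j : ℝ) ^ j := by exact_mod_cast j.factorial_le_pow
  have hcq : C * q ^ j ≤ max C q ^ (j + 1) := by
    rw [pow_succ']
    exact mul_le_mul (le_max_left _ _) (pow_le_pow_left₀ hq.le (le_max_right _ _) j)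
      (by positivity) (hC.le.trans (le_max_left _ _))
  exact mul_le_mul_of_nonneg_right (mul_le_mul hcq hfac (by positivity)
    ((by positivity : 0 ≤ C * q ^ j).trans hcq)) (Real.exp_pos _).le
end

section
/- Let a : ℝ^d → ℝ be a smooth function such that |Δ^j a(x)| ≤ A₃^{j+1} j^j e^{A₄|x|²} for all j = 0,1,2,… and all x ∈ ℝ^d, where A₃ and A₄ are positive constants. Then there exists δ > 0 (depending only on A₃) such that the function u(t,x) = Σ_{j=0}^∞ Δ^j a(x) (−t)^j / j! is well defined (the series converges absolutely and uniformly on [0,δ] × B(0,R) for every R > 0), is a smooth solution of the backward heat equation ∂_t u + Δu = 0 on (0,δ) × ℝ^d with u(0,x) = a(x), and has exponential growth of order 2: |u(t,x)| ≤ C A₃ e^{A₄|x|²} for some constant C and all (t,x) ∈ [0,δ) × ℝ^d. -/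
open Real Set

open Filter Topology

/-- At a local maximum, second derivatives along lines are nonpositive. -/
theorem deriv_deriv_nonpos_of_isLocalMax {h : ℝ → ℝ} {x : ℝ} (hc : ContinuousAt h x)
    (hmax : IsLocalMax h x) : deriv (deriv h) x ≤ 0 := by
  by_contra! hpos
  have hmin : IsLocalMin h x := isLocalMin_of_deriv_deriv_pos hpos hmax.deriv_eq_zero hc
  have hconst : h =ᶠ[𝓝 x] fun _ => h x := by
    filter_upwards [hmax, hmin] with y h1 h2 using le_antisymm h1 h2
  have h0 : deriv (deriv h) x = 0 := by
    rw [hconst.deriv.deriv_eq]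
    simp
  exact hpos.ne' h0

section HeatSeries

variable {d : ℕ}

local notation "𝔼" => EuclideanSpace ℝ (Fin d)

/-- The `i`-th partial derivative. -/
noncomputable def partialDeriv (i : Fin d) (f : EuclideanSpace ℝ (Fin d) → ℝ)
    (x : EuclideanSpace ℝ (Fin d)) : ℝ :=
  fderiv ℝ f x (EuclideanSpace.single i 1)

theorem Lap_eq_sum_partialDeriv (f : 𝔼 → ℝ) (x : 𝔼) :
    Lap f x = ∑ i, partialDeriv i (partialDeriv i f) x := rfl

theorem ContDiff.partialDeriv {f : 𝔼 → ℝ} (hf : ContDiff ℝ (⊤ : ℕ∞) f) (i : Fin d) :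
    ContDiff ℝ (⊤ : ℕ∞) (partialDeriv i f) :=
  (hf.fderiv_right (m := (⊤ : ℕ∞)) (by simp)).clm_apply contDiff_const

theorem hasDerivAt_comp_line {f : 𝔼 → ℝ} (hf : Differentiable ℝ f) (x : 𝔼) (i : Fin d)
    (ε s : ℝ) :
    HasDerivAt (fun s : ℝ => f (x + (ε * s) • EuclideanSpace.single i (1 : ℝ)))
      (ε * partialDeriv i f (x + (ε * s) • EuclideanSpace.single i (1 : ℝ))) s := by
  have h1 : HasDerivAt (fun s : ℝ => x + (ε * s) • EuclideanSpace.single i (1 : ℝ))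
      (ε • EuclideanSpace.single i (1 : ℝ)) s := by
    simpa using (((hasDerivAt_id s).const_mul ε).smul_const
      (EuclideanSpace.single i (1 : ℝ) : 𝔼)).const_add x
  have h2 := (hf _).hasFDerivAt.comp_hasDerivAt s h1
  simpa [partialDeriv, Function.comp_def] using h2

/-- Reflection in the hyperplane orthogonal to the `i`-th basis vector. -/
noncomputable def reflectCoord (i : Fin d) (y : EuclideanSpace ℝ (Fin d)) :
    EuclideanSpace ℝ (Fin d) :=
  y - (2 * y i) • EuclideanSpace.single i (1 : ℝ)

theorem norm_add_smul_single_sq (y : 𝔼) (i : Fin d) (s : ℝ) :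
    ‖y + s • EuclideanSpace.single i (1 : ℝ)‖ ^ 2 = ‖y‖ ^ 2 + 2 * y i * s + s ^ 2 := by
  rw [norm_add_sq_real, inner_smul_right, norm_smul]
  simp [EuclideanSpace.inner_single_right]
  ring

theorem norm_reflectCoord (i : Fin d) (y : 𝔼) : ‖reflectCoord i y‖ = ‖y‖ := by
  have h := norm_add_smul_single_sq y i (-(2 * y i))
  rw [neg_smul, ← sub_eq_add_neg] at h
  have h2 : ‖reflectCoord i y‖ ^ 2 = ‖y‖ ^ 2 := by
    rw [reflectCoord, h]; ring
  exact (sq_eq_sq₀ (norm_nonneg _) (norm_nonneg _)).1 h2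

theorem continuous_reflectCoord (i : Fin d) : Continuous (reflectCoord i) := by
  unfold reflectCoord
  fun_prop

theorem reflectCoord_add_smul (i k : Fin d) (y : 𝔼) (s : ℝ) :
    reflectCoord i (y + s • EuclideanSpace.single k (1 : ℝ)) =
      reflectCoord i y + ((if k = i then -1 else 1) * s) • EuclideanSpace.single k (1 : ℝ) := by
  unfold reflectCoord
  split_ifs with h
  · subst h
    simp only [PiLp.add_apply, PiLp.smul_apply, PiLp.single_apply, if_true, smul_eq_mul]
    module
  · have : ¬ i = k := fun h' => h h'.symm
    simp only [PiLp.add_apply, PiLp.smul_apply, PiLp.single_apply, if_neg this,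
      smul_eq_mul]
    module

/-- The comparison function for the interior gradient estimate. -/
noncomputable def gradientBarrier (f : EuclideanSpace ℝ (Fin d) → ℝ)
    (x : EuclideanSpace ℝ (Fin d)) (i : Fin d) (M N : ℝ) (y : EuclideanSpace ℝ (Fin d)) : ℝ :=
  f (x + y) - f (x + reflectCoord i y) -
    (2 * M * (‖y‖ ^ 2 + d * (y i * (1 - y i))) + N * (y i * (1 - y i)))

theorem deriv_deriv_gradientBarrier {f : 𝔼 → ℝ} (hf : ContDiff ℝ (⊤ : ℕ∞) f) (x : 𝔼)
    (i : Fin d) (M N : ℝ) (y : 𝔼) (k : Fin d) :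
    deriv (deriv fun s : ℝ =>
      gradientBarrier f x i M N (y + s • EuclideanSpace.single k (1 : ℝ))) 0 =
      partialDeriv k (partialDeriv k f) (x + y) -
        partialDeriv k (partialDeriv k f) (x + reflectCoord i y) -
        (4 * M - if k = i then 4 * M * d + 2 * N else 0) := by
  set ε : ℝ := if k = i then -1 else 1 with hε
  set ι : ℝ := if k = i then 1 else 0 with hι
  have hεε : ε * ε = 1 := by rw [hε]; split_ifs <;> norm_num
  have hιι : ι * ι = ι := by rw [hι]; split_ifs <;> norm_num
  have hfd : Differentiable ℝ f := hf.differentiable (by simp)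
  have hfd' : Differentiable ℝ (partialDeriv k f) := (hf.partialDeriv k).differentiable (by simp)
  have hfun : (fun s : ℝ =>
      gradientBarrier f x i M N (y + s • EuclideanSpace.single k (1 : ℝ))) = fun s : ℝ =>
      f ((x + y) + (1 * s) • EuclideanSpace.single k (1 : ℝ)) -
        f ((x + reflectCoord i y) + (ε * s) • EuclideanSpace.single k (1 : ℝ)) -
        (2 * M * (‖y‖ ^ 2 + 2 * y k * s + s ^ 2 + d * ((y i + s * ι) * (1 - (y i + s * ι)))) +
          N * ((y i + s * ι) * (1 - (y i + s * ι)))) := by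
    funext s
    have hyi : (y + s • EuclideanSpace.single k (1 : ℝ) : 𝔼) i = y i + s * ι := by
      simp [hι, eq_comm]
    rw [gradientBarrier, hyi, reflectCoord_add_smul, norm_add_smul_single_sq, one_mul,
      add_assoc x, add_assoc x]
  have hid := fun s : ℝ => hasDerivAt_id' s
  have hlin := fun s : ℝ => (((hid s).mul_const ι).const_add (y i))
  have hquad := fun s : ℝ => (hlin s).mul ((hlin s).const_sub 1)
  have h1 : (deriv fun s : ℝ =>
      gradientBarrier f x i M N (y + s • EuclideanSpace.single k (1 : ℝ))) = fun s : ℝ =>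
      1 * partialDeriv k f ((x + y) + (1 * s) • EuclideanSpace.single k (1 : ℝ)) -
        ε * partialDeriv k f
          ((x + reflectCoord i y) + (ε * s) • EuclideanSpace.single k (1 : ℝ)) -
        (2 * M * (2 * y k + 2 * s + d * (ι * (1 - 2 * y i) - 2 * ι * s)) +
          N * (ι * (1 - 2 * y i) - 2 * ι * s)) := by
    rw [hfun]
    funext s
    have hq : HasDerivAt (fun s : ℝ => (y i + s * ι) * (1 - (y i + s * ι)))
        (ι * (1 - 2 * y i) - 2 * ι * s) s := by
      convert! hquad s using 1
      linear_combination 2 * s * hιι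
    have hn : HasDerivAt (fun s : ℝ => ‖y‖ ^ 2 + 2 * y k * s + s ^ 2) (2 * y k + 2 * s) s := by
      convert! (((hid s).const_mul (2 * y k)).const_add (‖y‖ ^ 2)).add ((hid s).pow 2) using 1
      simp
    exact (((hasDerivAt_comp_line hfd (x + y) k 1 s).sub
      (hasDerivAt_comp_line hfd (x + reflectCoord i y) k ε s)).sub
      (((hn.add (hq.const_mul (d : ℝ))).const_mul (2 * M)).add (hq.const_mul N))).deriv
  rw [h1]
  have hq2 : HasDerivAt (fun s : ℝ => ι * (1 - 2 * y i) - 2 * ι * s) (-(2 * ι)) 0 := by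
    simpa using ((hid 0).const_mul (2 * ι)).const_sub (ι * (1 - 2 * y i))
  have hn2 : HasDerivAt (fun s : ℝ => 2 * y k + 2 * s) 2 0 := by
    simpa using ((hid 0).const_mul 2).const_add (2 * y k)
  have h2 := ((((hasDerivAt_comp_line hfd' (x + y) k 1 0).const_mul 1).sub
      ((hasDerivAt_comp_line hfd' (x + reflectCoord i y) k ε 0).const_mul ε)).sub
      (((hn2.add (hq2.const_mul (d : ℝ))).const_mul (2 * M)).add (hq2.const_mul N))).deriv
  refine Eq.trans h2 ?_
  simp only [mul_zero, zero_smul, add_zero, ← mul_assoc, hεε, hι]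
  split_ifs <;> ring

theorem gradientBarrier_nonpos {f : 𝔼 → ℝ} (hf : ContDiff ℝ (⊤ : ℕ∞) f) (x : 𝔼)
    (i : Fin d) {M N : ℝ} (hM : ∀ y ∈ Metric.closedBall x 1, |f y| ≤ M)
    (hN : ∀ y ∈ Metric.closedBall x 1, |Lap f y| < N) {y : 𝔼} (hy : ‖y‖ ≤ 1) (hyi : 0 ≤ y i) :
    gradientBarrier f x i M N y ≤ 0 := by
  have hM0 : 0 ≤ M := (abs_nonneg _).trans (hM x (by simp))
  have hN0 : 0 ≤ N := (abs_nonneg _).trans (hN x (by simp)).le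
  have hmem : ∀ z : 𝔼, ‖z‖ ≤ 1 → x + z ∈ Metric.closedBall x 1 := fun z hz => by simpa using hz
  have hcont : Continuous (gradientBarrier f x i M N) := by
    have h1 := hf.continuous
    have h2 := continuous_reflectCoord i
    unfold gradientBarrier
    fun_prop
  set K : Set 𝔼 := Metric.closedBall 0 1 ∩ {z | 0 ≤ z i} with hK
  have hKc : IsCompact K :=
    (isCompact_closedBall 0 1).inter_right (isClosed_le continuous_const (by fun_prop))
  have hyK : y ∈ K := ⟨by simpa using hy, hyi⟩
  obtain ⟨z, hzK, hz⟩ := hKc.exists_isMaxOn ⟨y, hyK⟩ hcont.continuousOn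
  refine (hz hyK).trans ?_
  have hz1 : ‖z‖ ≤ 1 := by simpa using hzK.1
  have hzi : 0 ≤ z i := hzK.2
  have hzi1 : z i ≤ 1 := (le_abs_self _).trans ((PiLp.norm_apply_le z i).trans hz1)
  have hp : 0 ≤ z i * (1 - z i) := mul_nonneg hzi (by linarith)
  rcases hzi.eq_or_lt with h0 | h0
  · have : reflectCoord i z = z := by simp [reflectCoord, ← h0]
    simp only [gradientBarrier, this, ← h0]
    nlinarith [mul_nonneg hM0 (sq_nonneg ‖z‖)]
  rcases hz1.eq_or_lt with h1 | h1
  · have a1 := abs_le.1 (hM _ (hmem z hz1))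
    have a2 := abs_le.1 (hM _ (hmem (reflectCoord i z) (by rwa [norm_reflectCoord])))
    simp only [gradientBarrier, h1]
    have b1 : 0 ≤ M * (d * (z i * (1 - z i))) := by positivity
    have b2 : 0 ≤ N * (z i * (1 - z i)) := by positivity
    nlinarith
  exfalso
  have hmax : IsLocalMax (gradientBarrier f x i M N) z := by
    have hnhds : K ∈ 𝓝 z := by
      refine Filter.inter_mem (Metric.closedBall_mem_nhds_of_mem (by simpa using h1)) ?_
      have : Continuous fun z : 𝔼 => z i := by fun_prop
      filter_upwards [this.continuousAt.eventually (lt_mem_nhds h0)] with w hw using le_of_lt hw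
    exact hz.isLocalMax hnhds
  have hk : ∀ k : Fin d, partialDeriv k (partialDeriv k f) (x + z) -
        partialDeriv k (partialDeriv k f) (x + reflectCoord i z) -
        (4 * M - if k = i then 4 * M * d + 2 * N else 0) ≤ 0 := by
    intro k
    rw [← deriv_deriv_gradientBarrier hf]
    have hl : Continuous fun s : ℝ => z + s • (EuclideanSpace.single k (1 : ℝ) : 𝔼) := by
      fun_prop
    apply deriv_deriv_nonpos_of_isLocalMax (hcont.comp hl).continuousAt
    have := hl.continuousAt (x := 0)
    simp only [ContinuousAt, zero_smul, add_zero] at this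
    simpa [IsLocalMax, IsMaxFilter] using this.eventually hmax
  have hsum := Finset.sum_nonpos fun k (_ : k ∈ Finset.univ) => hk k
  simp only [Finset.sum_sub_distrib, Finset.sum_ite_eq', Finset.mem_univ, if_true,
    Finset.sum_const, Finset.card_univ, Fintype.card_fin, nsmul_eq_mul,
    ← Lap_eq_sum_partialDeriv] at hsum
  have a1 := abs_lt.1 (hN _ (hmem z hz1))
  have a2 := abs_lt.1 (hN _ (hmem (reflectCoord i z) (by rwa [norm_reflectCoord])))
  nlinarith

theorem partialDeriv_le {f : 𝔼 → ℝ} (hf : ContDiff ℝ (⊤ : ℕ∞) f) (x : 𝔼)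
    (i : Fin d) {M N : ℝ} (hM : ∀ y ∈ Metric.closedBall x 1, |f y| ≤ M)
    (hN : ∀ y ∈ Metric.closedBall x 1, |Lap f y| < N) :
    partialDeriv i f x ≤ d * M + N / 2 := by
  have hfd : Differentiable ℝ f := hf.differentiable (by simp)
  have hd1 := hasDerivAt_comp_line hfd x i 1 0
  have hd2 := hasDerivAt_comp_line hfd x i (-1) 0
  have hd3 : HasDerivAt (fun s : ℝ => 2 * M * (s ^ 2 + d * (s * (1 - s))) + N * (s * (1 - s)))
      (2 * M * d + N) 0 := by
    have hq : HasDerivAt (fun s : ℝ => s * (1 - s)) 1 0 := by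
      simpa using (hasDerivAt_id' (0 : ℝ)).fun_mul ((hasDerivAt_id' (0 : ℝ)).const_sub 1)
    have hs : HasDerivAt (fun s : ℝ => s ^ 2) 0 0 := by
      simpa using (hasDerivAt_id' (0 : ℝ)).fun_pow 2
    simpa using ((hs.fun_add (hq.const_mul (d : ℝ))).const_mul (2 * M)).fun_add (hq.const_mul N)
  have hd := (hd1.sub hd2).sub hd3
  have hle : ∀ s ∈ Set.Ioo (0 : ℝ) 1, f (x + (1 * s) • EuclideanSpace.single i (1 : ℝ)) -
      f (x + (-1 * s) • EuclideanSpace.single i (1 : ℝ)) -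
      (2 * M * (s ^ 2 + d * (s * (1 - s))) + N * (s * (1 - s))) ≤ 0 := by
    intro s hs
    have h := gradientBarrier_nonpos hf x i hM hN
      (y := s • EuclideanSpace.single i (1 : ℝ))
      (by simpa [norm_smul, abs_of_pos hs.1] using hs.2.le) (by simpa using hs.1.le)
    have hr : reflectCoord i (s • EuclideanSpace.single i (1 : ℝ)) =
        (-1 * s) • EuclideanSpace.single i (1 : ℝ) := by
      simp only [reflectCoord, PiLp.smul_apply, PiLp.single_apply, if_true, smul_eq_mul]
      module
    rw [gradientBarrier, hr] at h
    simpa [norm_smul] using h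
  have hslope := (hasDerivWithinAt_iff_tendsto_slope' (s := Set.Ioi 0) (by simp)).1
    hd.hasDerivWithinAt
  have hnonpos := le_of_tendsto hslope (b := 0) (by
    filter_upwards [Ioo_mem_nhdsGT (zero_lt_one (α := ℝ))] with s hs
    have := hle s hs
    simp only [slope_def_field]
    refine div_nonpos_of_nonpos_of_nonneg ?_ (by linarith [hs.1])
    simpa using this)
  simp only [mul_zero, zero_smul, add_zero] at hnonpos
  linarith

theorem partialDeriv_neg (i : Fin d) (f : 𝔼 → ℝ) :
    partialDeriv i (fun y => -f y) = fun y => -partialDeriv i f y := by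
  funext x
  simp [partialDeriv, fderiv_fun_neg]

/-- Interior gradient estimate for the Laplacian. -/
theorem abs_partialDeriv_le {f : 𝔼 → ℝ} (hf : ContDiff ℝ (⊤ : ℕ∞) f) (x : 𝔼)
    (i : Fin d) {M N : ℝ} (hM : ∀ y ∈ Metric.closedBall x 1, |f y| ≤ M)
    (hN : ∀ y ∈ Metric.closedBall x 1, |Lap f y| < N) :
    |partialDeriv i f x| ≤ d * M + N / 2 := by
  refine abs_le.2 ⟨?_, partialDeriv_le hf x i hM hN⟩
  have h := partialDeriv_le hf.neg x i (M := M) (N := N) (by simpa using hM) (by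
    simpa [Lap_eq_sum_partialDeriv, partialDeriv_neg] using hN)
  rw [partialDeriv_neg] at h
  linarith

theorem partialDeriv_comm {f : 𝔼 → ℝ} (hf : ContDiff ℝ (⊤ : ℕ∞) f) (i k : Fin d) :
    partialDeriv i (partialDeriv k f) = partialDeriv k (partialDeriv i f) := by
  have key : ∀ (j l : Fin d) (x : 𝔼), partialDeriv j (partialDeriv l f) x =
      fderiv ℝ (fderiv ℝ f) x (EuclideanSpace.single j 1) (EuclideanSpace.single l 1) := by
    intro j l x
    have hd : DifferentiableAt ℝ (fderiv ℝ f) x :=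
      (hf.fderiv_right (m := (⊤ : ℕ∞)) (by simp)).differentiable (by simp) x
    have := hd.hasFDerivAt.clm_apply
      (hasFDerivAt_const (EuclideanSpace.single l (1 : ℝ) : 𝔼) x)
    unfold partialDeriv
    rw [this.fderiv]
    simp
  funext x
  rw [key, key]
  have h2 : minSmoothness ℝ 2 ≤ ((⊤ : ℕ∞) : WithTop ℕ∞) := by
    rw [minSmoothness_of_isRCLikeNormedField]
    exact WithTop.coe_le_coe.2 (le_top : (2 : ℕ∞) ≤ ⊤)
  exact hf.contDiffAt.isSymmSndFDerivAt h2 _ _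

theorem ContDiff.Lap {f : 𝔼 → ℝ} (hf : ContDiff ℝ (⊤ : ℕ∞) f) :
    ContDiff ℝ (⊤ : ℕ∞) (Lap f) :=
  ContDiff.sum fun i _ => (hf.partialDeriv i).partialDeriv i

theorem partialDeriv_Lap {f : 𝔼 → ℝ} (hf : ContDiff ℝ (⊤ : ℕ∞) f) (i : Fin d) :
    Lap (partialDeriv i f) = partialDeriv i (Lap f) := by
  funext x
  have h : fderiv ℝ (Lap f) x =
      ∑ k, fderiv ℝ (partialDeriv k (partialDeriv k f)) x :=
    fderiv_fun_sum fun k _ =>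
      (((hf.partialDeriv k).partialDeriv k).differentiable (by simp)) x
  rw [partialDeriv, h, _root_.sum_apply, Lap_eq_sum_partialDeriv]
  refine Finset.sum_congr rfl fun k _ => ?_
  rw [← partialDeriv_comm hf i k, ← partialDeriv_comm (hf.partialDeriv k) i k]
  rfl

/-- Smooth sequences with `Δ (c j) = c (j + 1)` whose terms are bounded on balls by a constant
times `j! / ρ ^ j`, for every `ρ < T`. -/
structure IsHeatSeq (T : ℝ) (c : ℕ → EuclideanSpace ℝ (Fin d) → ℝ) : Prop where
  contDiff : ∀ j, ContDiff ℝ (⊤ : ℕ∞) (c j)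
  lap : ∀ j, Lap (c j) = c (j + 1)
  bound : ∀ R ρ : ℝ, 0 < ρ → ρ < T →
    ∃ C, ∀ (j : ℕ) (x : EuclideanSpace ℝ (Fin d)), ‖x‖ ≤ R → |c j x| * ρ ^ j ≤ C * j.factorial

namespace IsHeatSeq

variable {T : ℝ} {c : ℕ → EuclideanSpace ℝ (Fin d) → ℝ}

theorem shift (hc : IsHeatSeq T c) : IsHeatSeq T fun j => c (j + 1) where
  contDiff j := hc.contDiff (j + 1)
  lap j := hc.lap (j + 1)
  bound R ρ hρ hρT := by
    obtain ⟨σ, hρσ, hσT⟩ := exists_between hρT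
    have hσ : 0 < σ := hρ.trans hρσ
    obtain ⟨C, hC⟩ := hc.bound R σ hσ hσT
    obtain ⟨B, hB⟩ := (tendsto_self_mul_const_pow_of_abs_lt_one (r := ρ / σ) (by
      rw [abs_of_pos (by positivity), div_lt_one hσ]; exact hρσ)).bddAbove_range
    have hB' : ∀ j : ℕ, (j : ℝ) * (ρ / σ) ^ j ≤ B := fun j => hB ⟨j, rfl⟩
    refine ⟨|C| * B / ρ, fun j x hx => ?_⟩
    have h1 : |c (j + 1) x| * σ ^ (j + 1) ≤ |C| * (j + 1).factorial :=
      (hC (j + 1) x hx).trans (by gcongr; exact le_abs_self C)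
    have h2 := hB' (j + 1)
    rw [div_pow] at h2
    have h3 : |c (j + 1) x| * ρ ^ j =
        (|c (j + 1) x| * σ ^ (j + 1)) * (ρ ^ (j + 1) / σ ^ (j + 1)) / ρ := by
      field_simp
      ring
    rw [h3]
    calc _ ≤ (|C| * (j + 1).factorial) * (ρ ^ (j + 1) / σ ^ (j + 1)) / ρ := by gcongr
      _ = |C| * (((j + 1 : ℕ) : ℝ) * (ρ ^ (j + 1) / σ ^ (j + 1))) / ρ * j.factorial := by
        rw [Nat.factorial_succ]; push_cast; ring
      _ ≤ _ := by gcongr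

theorem partialDeriv (hc : IsHeatSeq T c) (i : Fin d) :
    IsHeatSeq T fun j => partialDeriv i (c j) where
  contDiff j := (hc.contDiff j).partialDeriv i
  lap j := by rw [partialDeriv_Lap (hc.contDiff j), hc.lap]
  bound R ρ hρ hρT := by
    obtain ⟨C, hC⟩ := hc.bound (R + 1) ρ hρ hρT
    obtain ⟨D, hD⟩ := hc.shift.bound (R + 1) ρ hρ hρT
    refine ⟨d * C + (D + 1) / 2, fun j x hx => ?_⟩
    have hball : ∀ y ∈ Metric.closedBall x 1, ‖y‖ ≤ R + 1 := fun y hy => by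
      have : ‖y‖ ≤ ‖x‖ + ‖y - x‖ := by simpa using norm_add_le x (y - x)
      rw [mem_closedBall_iff_norm] at hy
      linarith
    have hpow : 0 < ρ ^ j := by positivity
    have hfac : (0 : ℝ) < j.factorial := by positivity
    have h := abs_partialDeriv_le (hc.contDiff j) x i (M := C * j.factorial / ρ ^ j)
      (N := (D + 1) * j.factorial / ρ ^ j)
      (fun y hy => (le_div_iff₀ hpow).2 (hC j y (hball y hy)))
      (fun y hy => by
        rw [hc.lap, lt_div_iff₀ hpow]
        have := hD j y (hball y hy)
        linarith)
    calc _ ≤ (d * (C * j.factorial / ρ ^ j) + (D + 1) * j.factorial / ρ ^ j / 2) * ρ ^ j := by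
          gcongr
      _ = _ := by field_simp

end IsHeatSeq

/-- The `j`-th term of the formal solution of the backward heat equation. -/
noncomputable def heatTerm (c : ℕ → EuclideanSpace ℝ (Fin d) → ℝ) (j : ℕ)
    (p : ℝ × EuclideanSpace ℝ (Fin d)) : ℝ :=
  c j p.2 * (-p.1) ^ j / (j.factorial : ℝ)

/-- The formal solution of the backward heat equation attached to the sequence `c`. -/
noncomputable def heatSeries (c : ℕ → EuclideanSpace ℝ (Fin d) → ℝ)
    (p : ℝ × EuclideanSpace ℝ (Fin d)) : ℝ :=
  ∑' j, heatTerm c j p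

/-- The time derivative of the `j`-th term of the formal solution. -/
noncomputable def heatTermTime (c : ℕ → EuclideanSpace ℝ (Fin d) → ℝ) :
    ℕ → ℝ × EuclideanSpace ℝ (Fin d) → ℝ
  | 0, _ => 0
  | j + 1, p => -heatTerm (fun j => c (j + 1)) j p

/-- The total derivative with prescribed time derivative and partial space derivatives. -/
noncomputable def spaceTimeCLM (A : ℝ) (B : Fin d → ℝ) :
    ℝ × EuclideanSpace ℝ (Fin d) →L[ℝ] ℝ :=
  A • ContinuousLinearMap.fst ℝ ℝ (EuclideanSpace ℝ (Fin d)) +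
    ∑ i, B i • (EuclideanSpace.proj i : EuclideanSpace ℝ (Fin d) →L[ℝ] ℝ).comp
      (ContinuousLinearMap.snd ℝ ℝ (EuclideanSpace ℝ (Fin d)))

theorem spaceTimeCLM_apply (A : ℝ) (B : Fin d → ℝ) (p : ℝ × 𝔼) :
    spaceTimeCLM A B p = A * p.1 + ∑ i, B i * p.2 i := by
  simp [spaceTimeCLM, _root_.sum_apply]

theorem norm_spaceTimeCLM_le (A : ℝ) (B : Fin d → ℝ) :
    ‖spaceTimeCLM A B‖ ≤ |A| + ∑ i, |B i| := by
  refine ContinuousLinearMap.opNorm_le_bound _ (by positivity) fun p => ?_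
  rw [spaceTimeCLM_apply, Real.norm_eq_abs, add_mul, Finset.sum_mul]
  refine (abs_add_le _ _).trans (add_le_add ?_ ((Finset.abs_sum_le_sum_abs _ _).trans
    (Finset.sum_le_sum fun i _ => ?_)))
  · rw [abs_mul]
    gcongr
    exact norm_fst_le p
  · rw [abs_mul]
    gcongr
    exact (PiLp.norm_apply_le p.2 i).trans (norm_snd_le p)

theorem fderiv_apply_eq_sum_partialDeriv (f : 𝔼 → ℝ) (x v : 𝔼) :
    fderiv ℝ f x v = ∑ i, partialDeriv i f x * v i := by
  have hv : v = ∑ i, v i • EuclideanSpace.single i (1 : ℝ) := by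
    ext k
    simp [Finset.sum_apply, Pi.single_apply]
  conv_lhs => rw [hv]
  simp [map_sum, partialDeriv, mul_comm]

theorem hasFDerivAt_heatTerm {c : ℕ → 𝔼 → ℝ} (j : ℕ) (hc : Differentiable ℝ (c j))
    (p : ℝ × 𝔼) :
    HasFDerivAt (heatTerm c j)
      (spaceTimeCLM (heatTermTime c j p)
        fun i => heatTerm (fun j => partialDeriv i (c j)) j p) p := by
  have h1 : HasFDerivAt (fun p : ℝ × 𝔼 => c j p.2)
      ((fderiv ℝ (c j) p.2).comp (ContinuousLinearMap.snd ℝ ℝ 𝔼)) p :=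
    (hc p.2).hasFDerivAt.comp p hasFDerivAt_snd
  have h2 : HasFDerivAt (fun p : ℝ × 𝔼 => (-p.1) ^ j)
      ((j * (-p.1) ^ (j - 1) * (-1)) • ContinuousLinearMap.fst ℝ ℝ 𝔼) p := by
    have : HasDerivAt (fun t : ℝ => (-t) ^ j) (j * (-p.1) ^ (j - 1) * (-1)) p.1 :=
      (hasDerivAt_neg p.1).fun_pow j
    exact this.comp_hasFDerivAt p hasFDerivAt_fst
  have h3 := (h1.mul h2).mul_const ((j.factorial : ℝ)⁻¹)
  refine (h3.congr_fderiv ?_).congr_of_eventuallyEq (Eventually.of_forall fun q => ?_)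
  · refine ContinuousLinearMap.ext fun v => ?_
    rw [spaceTimeCLM_apply]
    simp only [_root_.smul_apply, _root_.add_apply,
      ContinuousLinearMap.comp_apply, ContinuousLinearMap.coe_fst', ContinuousLinearMap.coe_snd',
      smul_eq_mul, fderiv_apply_eq_sum_partialDeriv]
    rw [mul_add]
    congr 1
    · rcases j with _ | j
      · simp [heatTermTime]
      · simp only [heatTermTime, heatTerm, Nat.factorial_succ]
        push_cast
        field_simp
    · simp only [heatTerm, Finset.mul_sum]
      exact Finset.sum_congr rfl fun i _ => by ring
  · simp [heatTerm, div_eq_mul_inv]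

namespace IsHeatSeq

variable {T : ℝ} {c : ℕ → EuclideanSpace ℝ (Fin d) → ℝ}

theorem exists_summable_bound (hc : IsHeatSeq T c) (R : ℝ) {r : ℝ} (hr : 0 ≤ r) (hrT : r < T) :
    ∃ u : ℕ → ℝ, Summable u ∧
      ∀ (j : ℕ) (p : ℝ × 𝔼), |p.1| ≤ r → ‖p.2‖ ≤ R → |heatTerm c j p| ≤ u j := by
  obtain ⟨ρ, hrρ, hρT⟩ := exists_between hrT
  have hρ : 0 < ρ := hr.trans_lt hrρ
  obtain ⟨C, hC⟩ := hc.bound R ρ hρ hρT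
  refine ⟨fun j => C * (r / ρ) ^ j, (summable_geometric_of_lt_one (by positivity)
    ((div_lt_one hρ).2 hrρ)).mul_left C, fun j p hp hpR => ?_⟩
  have hfac : (0 : ℝ) < j.factorial := by positivity
  have h1 := hC j p.2 hpR
  have h2 : |heatTerm c j p| = |c j p.2| * |p.1| ^ j / j.factorial := by
    rw [heatTerm, abs_div, abs_mul, abs_pow, abs_neg, abs_of_pos hfac]
  rw [h2, div_le_iff₀ hfac]
  calc |c j p.2| * |p.1| ^ j ≤ |c j p.2| * r ^ j := by gcongr
    _ = (|c j p.2| * ρ ^ j) * (r / ρ) ^ j := by rw [div_pow]; field_simp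
    _ ≤ (C * j.factorial) * (r / ρ) ^ j := by gcongr
    _ = _ := by ring

theorem summable_heatTerm (hc : IsHeatSeq T c) {p : ℝ × 𝔼} (hp : |p.1| < T) :
    Summable fun j => heatTerm c j p := by
  obtain ⟨u, hu, h⟩ := hc.exists_summable_bound ‖p.2‖ (abs_nonneg p.1) hp
  exact hu.of_norm_bounded fun j => h j p le_rfl le_rfl

theorem hasSum_heatTermTime (hc : IsHeatSeq T c) {p : ℝ × 𝔼} (hp : |p.1| < T) :
    HasSum (fun j => heatTermTime c j p) (-heatSeries (fun j => c (j + 1)) p) := by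
  have h := (hc.shift.summable_heatTerm hp).hasSum.neg
  rw [← hasSum_nat_add_iff' 1]
  simpa [heatTermTime, heatSeries] using h

theorem hasFDerivAt_heatSeries (hc : IsHeatSeq T c) {p : ℝ × 𝔼} (hp : |p.1| < T) :
    HasFDerivAt (heatSeries c)
      (spaceTimeCLM (-heatSeries (fun j => c (j + 1)) p)
        fun i => heatSeries (fun j => _root_.partialDeriv i (c j)) p) p := by
  obtain ⟨r, hpr, hrT⟩ := exists_between hp
  have hr : 0 ≤ r := (abs_nonneg _).trans hpr.le
  set R : ℝ := ‖p.2‖ + 1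
  obtain ⟨u, hu, hub⟩ := hc.shift.exists_summable_bound R hr hrT
  choose v hv hvb using fun i : Fin d => (hc.partialDeriv i).exists_summable_bound R hr hrT
  set w : ℕ → ℝ := fun j => Nat.casesOn j 0 u with hw
  have hws : Summable w := (summable_nat_add_iff 1).1 hu
  have hderiv := hasFDerivAt_tsum_of_isPreconnected (𝕜 := ℝ) (f := heatTerm c)
    (f' := fun j p => spaceTimeCLM (heatTermTime c j p)
      fun i => heatTerm (fun j => _root_.partialDeriv i (c j)) j p)
    (u := fun j => w j + ∑ i, v i j) (s := Metric.ball (0 : ℝ) r ×ˢ Metric.ball (0 : 𝔼) R)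
    (x₀ := p) (x := p) (hws.add (summable_sum fun i _ => hv i))
    (Metric.isOpen_ball.prod Metric.isOpen_ball)
    ((convex_ball _ _).prod (convex_ball _ _)).isPreconnected
    (fun j q _ => hasFDerivAt_heatTerm j ((hc.contDiff j).differentiable (by simp)) q)
    (fun j q hq => ?_) ?_ (hc.summable_heatTerm hp) ?_
  · refine hderiv.congr_fderiv ?_
    have hsum : HasSum (fun j => spaceTimeCLM (heatTermTime c j p)
        fun i => heatTerm (fun j => _root_.partialDeriv i (c j)) j p)
        (spaceTimeCLM (-heatSeries (fun j => c (j + 1)) p)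
          fun i => heatSeries (fun j => _root_.partialDeriv i (c j)) p) :=
      ((hc.hasSum_heatTermTime hp).smul_const _).add
        (hasSum_sum fun i _ => ((hc.partialDeriv i).summable_heatTerm hp).hasSum.smul_const _)
    exact hsum.tsum_eq
  · have hq1 : |q.1| ≤ r := by simpa using (Metric.mem_ball.1 hq.1).le
    have hq2 : ‖q.2‖ ≤ R := by simpa using (Metric.mem_ball.1 hq.2).le
    refine (norm_spaceTimeCLM_le _ _).trans
      (add_le_add ?_ (Finset.sum_le_sum fun i _ => hvb i j q hq1 hq2))
    rcases j with _ | j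
    · simp [heatTermTime, hw]
    · simpa [heatTermTime, hw] using hub j q hq1 hq2
  all_goals exact ⟨by simpa using hpr, by simp [R]⟩

theorem contDiffOn_heatSeries_nat (n : ℕ) :
    ∀ {c : ℕ → EuclideanSpace ℝ (Fin d) → ℝ}, IsHeatSeq T c →
      ContDiffOn ℝ n (heatSeries c) {p | |p.1| < T} := by
  have hopen : IsOpen {p : ℝ × 𝔼 | |p.1| < T} :=
    isOpen_lt (continuous_abs.comp continuous_fst) continuous_const
  induction n with
  | zero =>
    intro c hc
    exact contDiffOn_zero.2 fun p hp =>
      (hc.hasFDerivAt_heatSeries hp).continuousAt.continuousWithinAt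
  | succ n ih =>
    intro c hc
    push_cast
    refine (contDiffOn_succ_iff_hasFDerivWithinAt_of_uniqueDiffOn hopen.uniqueDiffOn).2
      ⟨by simp, _, ?_, fun p hp => (hc.hasFDerivAt_heatSeries hp).hasFDerivWithinAt⟩
    exact ((ih hc.shift).neg.smul contDiffOn_const).add
      (ContDiffOn.sum fun i _ => (ih (hc.partialDeriv i)).smul contDiffOn_const)

theorem contDiffOn_heatSeries (hc : IsHeatSeq T c) :
    ContDiffOn ℝ (⊤ : ℕ∞) (heatSeries c) {p | |p.1| < T} :=
  contDiffOn_infty.2 fun n => contDiffOn_heatSeries_nat n hc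

theorem deriv_heatSeries (hc : IsHeatSeq T c) {t : ℝ} (ht : |t| < T) (x : 𝔼) :
    deriv (fun s => heatSeries c (s, x)) t = -heatSeries (fun j => c (j + 1)) (t, x) := by
  have h := (hc.hasFDerivAt_heatSeries (p := (t, x)) ht).comp_hasDerivAt t
    ((hasDerivAt_id t).prodMk (hasDerivAt_const t x))
  simpa [spaceTimeCLM_apply, Function.comp_def] using h.deriv

theorem partialDeriv_heatSeries (hc : IsHeatSeq T c) {t : ℝ} (ht : |t| < T) (i : Fin d) :
    _root_.partialDeriv i (fun x => heatSeries c (t, x)) =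
      fun x => heatSeries (fun j => _root_.partialDeriv i (c j)) (t, x) := by
  funext x
  have h := (hc.hasFDerivAt_heatSeries (p := (t, x)) ht).comp x
    ((hasFDerivAt_const t x).prodMk (hasFDerivAt_id x))
  have h' : HasFDerivAt (fun x => heatSeries c (t, x)) _ x := h
  rw [_root_.partialDeriv, h'.fderiv]
  simp [spaceTimeCLM_apply, PiLp.single_apply]

theorem Lap_heatSeries (hc : IsHeatSeq T c) {t : ℝ} (ht : |t| < T) (x : 𝔼) :
    Lap (fun x => heatSeries c (t, x)) x = heatSeries (fun j => c (j + 1)) (t, x) := by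
  rw [Lap_eq_sum_partialDeriv]
  simp only [hc.partialDeriv_heatSeries ht, (hc.partialDeriv _).partialDeriv_heatSeries ht]
  have h := hasSum_sum (s := Finset.univ) fun i (_ : i ∈ Finset.univ) =>
    (((hc.partialDeriv i).partialDeriv i).summable_heatTerm (p := (t, x)) ht).hasSum
  refine h.tsum_eq.symm.trans (tsum_congr fun j => ?_)
  simp only [heatTerm, ← hc.lap, Lap_eq_sum_partialDeriv, Finset.sum_mul, Finset.sum_div]

end IsHeatSeq

theorem natCast_pow_self_le (j : ℕ) : (j : ℝ) ^ j ≤ Real.exp 1 ^ j * j.factorial := by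
  have h := Real.pow_div_factorial_le_exp (j : ℝ) (Nat.cast_nonneg j) j
  rwa [div_le_iff₀ (by positivity), ← Real.exp_one_pow] at h

theorem contDiff_iterate_Lap {a : 𝔼 → ℝ} (ha : ContDiff ℝ (⊤ : ℕ∞) a) (j : ℕ) :
    ContDiff ℝ (⊤ : ℕ∞) (Lap^[j] a) := by
  induction j with
  | zero => exact ha
  | succ j ih => rw [Function.iterate_succ_apply']; exact ih.Lap

theorem isHeatSeq_iterate_Lap {A₃ A₄ : ℝ} (hA₃ : 0 < A₃) (hA₄ : 0 < A₄) {a : 𝔼 → ℝ}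
    (ha : ContDiff ℝ (⊤ : ℕ∞) a)
    (hbound : ∀ (j : ℕ) (x),
      |Lap^[j] a x| ≤ A₃ ^ (j + 1) * (j : ℝ) ^ j * Real.exp (A₄ * ‖x‖ ^ 2)) :
    IsHeatSeq (1 / (Real.exp 1 * A₃)) fun j => Lap^[j] a where
  contDiff := contDiff_iterate_Lap ha
  lap j := (Function.iterate_succ_apply' _ _ _).symm
  bound R ρ hρ hρT := by
    refine ⟨A₃ * Real.exp (A₄ * R ^ 2), fun j x hx => ?_⟩
    have hq : Real.exp 1 * A₃ * ρ ≤ 1 := by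
      rw [lt_div_iff₀ (by positivity)] at hρT
      linarith
    calc |Lap^[j] a x| * ρ ^ j
        ≤ A₃ ^ (j + 1) * (Real.exp 1 ^ j * j.factorial) * Real.exp (A₄ * R ^ 2) * ρ ^ j := by
          refine mul_le_mul_of_nonneg_right ((hbound j x).trans ?_) (by positivity)
          gcongr
          exact natCast_pow_self_le j
      _ = A₃ * Real.exp (A₄ * R ^ 2) * j.factorial * (Real.exp 1 * A₃ * ρ) ^ j := by
          rw [mul_pow, mul_pow]; ring
      _ ≤ A₃ * Real.exp (A₄ * R ^ 2) * j.factorial * 1 := by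
          gcongr
          exact pow_le_one₀ (by positivity) hq
      _ = _ := mul_one _

theorem abs_heatTerm_iterate_Lap_le {A₃ A₄ : ℝ} (hA₃ : 0 < A₃) {a : 𝔼 → ℝ}
    (hbound : ∀ (j : ℕ) (x),
      |Lap^[j] a x| ≤ A₃ ^ (j + 1) * (j : ℝ) ^ j * Real.exp (A₄ * ‖x‖ ^ 2))
    {t : ℝ} (ht : |t| ≤ 1 / (2 * (Real.exp 1 * A₃))) (x : 𝔼) (j : ℕ) :
    |heatTerm (fun j => Lap^[j] a) j (t, x)| ≤
      A₃ * Real.exp (A₄ * ‖x‖ ^ 2) * (1 / 2) ^ j := by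
  have hfac : (0 : ℝ) < j.factorial := by positivity
  have hq : Real.exp 1 * A₃ * |t| ≤ 1 / 2 := by
    rw [le_div_iff₀ (by positivity)] at ht
    linarith
  rw [heatTerm, abs_div, abs_mul, abs_pow, abs_neg, abs_of_pos hfac, div_le_iff₀ hfac]
  calc |Lap^[j] a x| * |t| ^ j
      ≤ A₃ ^ (j + 1) * (Real.exp 1 ^ j * j.factorial) * Real.exp (A₄ * ‖x‖ ^ 2) * |t| ^ j := by
        refine mul_le_mul_of_nonneg_right ((hbound j x).trans ?_) (by positivity)
        gcongr
        exact natCast_pow_self_le j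
    _ = A₃ * Real.exp (A₄ * ‖x‖ ^ 2) * j.factorial * (Real.exp 1 * A₃ * |t|) ^ j := by
        rw [mul_pow, mul_pow]; ring
    _ ≤ A₃ * Real.exp (A₄ * ‖x‖ ^ 2) * j.factorial * (1 / 2) ^ j := by gcongr
    _ = _ := by ring

end HeatSeries

/-- **Sufficiency part of the solvability criterion for the backward heat equation.**
If `a` is smooth with `|Δʲ a(x)| ≤ A₃^{j+1} jʲ exp(A₄ |x|²)` for all `j`, then for some
`δ > 0` depending only on `A₃`, the series `u(t,x) = ∑_j Δʲa(x) (-t)ʲ/j!` converges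
absolutely, and uniformly on `[0,δ] × B(0,R)` for every `R > 0`; it defines a smooth
solution of the backward heat equation `∂ₜu + Δu = 0` on `(0,δ) × ℝ^d` with `u(0,·) = a`,
of exponential growth of order 2: `|u(t,x)| ≤ C A₃ exp(A₄ |x|²)`. -/
theorem backward_heat_sufficient (d : ℕ) (A₃ : ℝ) (hA₃ : 0 < A₃) :
    ∃ δ > (0:ℝ), ∃ C > (0:ℝ), ∀ (A₄ : ℝ), 0 < A₄ →
      ∀ a : EuclideanSpace ℝ (Fin d) → ℝ, ContDiff ℝ (⊤ : ℕ∞) a →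
      (∀ (j : ℕ) (x), |Lap^[j] a x| ≤ A₃^(j+1) * (j:ℝ)^j * Real.exp (A₄ * ‖x‖^2)) →
      ∃ u : ℝ → EuclideanSpace ℝ (Fin d) → ℝ,
        -- the series converges (absolutely) to `u` on `[0,δ] × ℝ^d`
        (∀ t ∈ Set.Icc (0:ℝ) δ, ∀ x,
          HasSum (fun j : ℕ => Lap^[j] a x * (-t)^j / (Nat.factorial j : ℝ)) (u t x)) ∧
        (∀ t ∈ Set.Icc (0:ℝ) δ, ∀ x,
          Summable (fun j : ℕ => |Lap^[j] a x * (-t)^j / (Nat.factorial j : ℝ)|)) ∧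
        -- uniform convergence on `[0,δ] × B(0,R)` for every `R > 0`
        (∀ R > (0:ℝ), TendstoUniformlyOn
          (fun (n : ℕ) (p : ℝ × EuclideanSpace ℝ (Fin d)) =>
            ∑ j ∈ Finset.range n, Lap^[j] a p.2 * (-p.1)^j / (Nat.factorial j : ℝ))
          (fun p => u p.1 p.2) Filter.atTop (Set.Icc (0:ℝ) δ ×ˢ Metric.ball 0 R)) ∧
        -- `u` is a smooth solution of the backward heat equation with initial value `a`
        ContDiffOn ℝ (⊤ : ℕ∞) (fun p : ℝ × EuclideanSpace ℝ (Fin d) => u p.1 p.2)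
          (Set.Ico 0 δ ×ˢ (Set.univ : Set (EuclideanSpace ℝ (Fin d)))) ∧
        (∀ t ∈ Set.Ioo (0:ℝ) δ, ∀ x, deriv (fun s => u s x) t + Lap (u t) x = 0) ∧
        (∀ x, u 0 x = a x) ∧
        -- exponential growth of order 2
        (∀ t ∈ Set.Ico (0:ℝ) δ, ∀ x, |u t x| ≤ C * A₃ * Real.exp (A₄ * ‖x‖^2)) := by
  set T : ℝ := 1 / (Real.exp 1 * A₃) with hT
  set δ : ℝ := 1 / (2 * (Real.exp 1 * A₃)) with hδ
  have hδ0 : 0 < δ := by positivity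
  have hδT : δ < T := by
    have : T = 2 * δ := by rw [hT, hδ]; field_simp
    linarith
  refine ⟨δ, hδ0, 2, two_pos, fun A₄ hA₄ a ha hbound => ?_⟩
  have hc := isHeatSeq_iterate_Lap hA₃ hA₄ ha hbound
  have habs : ∀ t ∈ Set.Icc (0 : ℝ) δ, |t| ≤ δ := fun t ht => by
    rw [abs_of_nonneg ht.1]; exact ht.2
  have hlt : ∀ t ∈ Set.Icc (0 : ℝ) δ, |t| < T := fun t ht => (habs t ht).trans_lt hδT
  refine ⟨fun t x => heatSeries (fun j => Lap^[j] a) (t, x), fun t ht x => ?_, fun t ht x => ?_,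
    fun R hR => ?_, ?_, fun t ht x => ?_, fun x => ?_, fun t ht x => ?_⟩
  · exact (hc.summable_heatTerm (p := (t, x)) (hlt t ht)).hasSum
  · exact (hc.summable_heatTerm (p := (t, x)) (hlt t ht)).abs
  · obtain ⟨v, hv, hvb⟩ := hc.exists_summable_bound R hδ0.le hδT
    exact tendstoUniformlyOn_tsum_nat hv fun j p hp =>
      hvb j p (habs p.1 hp.1) (by simpa using (Metric.mem_ball.1 hp.2).le)
  · exact hc.contDiffOn_heatSeries.mono fun p hp => hlt p.1 (Set.Ico_subset_Icc_self hp.1)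
  · have ht' := hlt t (Set.Ioo_subset_Icc_self ht)
    rw [hc.deriv_heatSeries ht', hc.Lap_heatSeries ht', neg_add_cancel]
  · refine (tsum_eq_single 0 fun j hj => ?_).trans ?_
    · simp [heatTerm, hj]
    · simp [heatTerm]
  · have hg := (hasSum_geometric_two).mul_left (A₃ * Real.exp (A₄ * ‖x‖ ^ 2))
    have h := tsum_of_norm_bounded (f := fun j => heatTerm (fun j => Lap^[j] a) j (t, x)) hg
      (abs_heatTerm_iterate_Lap_le hA₃ hbound (habs t (Set.Ico_subset_Icc_self ht)) x)
    calc _ ≤ A₃ * Real.exp (A₄ * ‖x‖ ^ 2) * 2 := h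
      _ = _ := by ring
end
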